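/- arXiv:2205.08829 — 9 statements merged into one kernel-verified Lean document; each statement's English description precedes it below -/
import Mathlib

section
/- Let λ, c > 0 be real constants and let f₀, f₁, f₂, f₃, f₄, f₅ : ℝ⁴ → ℝ be smooth (C^∞) functions of the variables (t,x,y,z) satisfying the first-order system: ∂f₀/∂t = −c ∂f₀/∂x + (λ/4)(f₁+f₂+f₄+f₅−4f₀); ∂f₃/∂t = c ∂f₃/∂x + (λ/4)(f₁+f₂+f₄+f₅−4f₃); ∂f₁/∂t = −c ∂f₁/∂y + (λ/4)(f₀+f₂+f₃+f₅−4f₁); ∂f₄/∂t = c ∂f₄/∂y + (λ/4)(f₀+f₂+f₃+f₅−4f₄); ∂f₂/∂t = −c ∂f₂/∂z + (λ/4)(f₀+f₁+f₃+f₄−4f₂); ∂f₅/∂t = c ∂f₅/∂z + (λ/4)(f₀+f₁+f₃+f₄−4f₅). Then p = f₀+f₁+f₂+f₃+f₄+f₅ satisfies the sixth-order equation (∂/∂t+λ)⁶ p − (3λ²/4)(∂/∂t+λ)⁴ p − (λ³/4)(∂/∂t+λ)³ p = c⁶ ∂⁶p/(∂x²∂y²∂z²) − c⁴ (∂/∂t+λ)²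 (∂⁴p/(∂x²∂y²) + ∂⁴p/(∂x²∂z²) + ∂⁴p/(∂y²∂z²)) + c² [(∂/∂t+λ)⁴ − (λ²/4)(∂/∂t+λ)²] Δp, where Δ = ∂²/∂x² + ∂²/∂y² + ∂²/∂z² is the spatial Laplace operator. -/
/-- Partial derivative in the first (time) variable of a function of four real variables. -/
noncomputable def pt4 (f : ℝ → ℝ → ℝ → ℝ → ℝ) : ℝ → ℝ → ℝ → ℝ → ℝ :=
  fun t x y z => deriv (fun s => f s x y z) t

/-- Partial derivative in the second (x) variable. -/
noncomputable def px4 (f : ℝ → ℝ → ℝ → ℝ → ℝ) : ℝ → ℝ → ℝ → ℝ → ℝ :=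
  fun t x y z => deriv (fun s => f t s y z) x

/-- Partial derivative in the third (y) variable. -/
noncomputable def py4 (f : ℝ → ℝ → ℝ → ℝ → ℝ) : ℝ → ℝ → ℝ → ℝ → ℝ :=
  fun t x y z => deriv (fun s => f t x s z) y

/-- Partial derivative in the fourth (z) variable. -/
noncomputable def pz4 (f : ℝ → ℝ → ℝ → ℝ → ℝ) : ℝ → ℝ → ℝ → ℝ → ℝ :=
  fun t x y z => deriv (fun s => f t x y s) z

/-- The operator (∂/∂t + λ). -/
noncomputable def Dop (lam : ℝ) (f : ℝ → ℝ → ℝ → ℝ → ℝ) : ℝ → ℝ → ℝ → ℝ → ℝ :=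
  fun t x y z => pt4 f t x y z + lam * f t x y z

/-- The spatial Laplacian Δ = ∂²/∂x² + ∂²/∂y² + ∂²/∂z². -/
noncomputable def lap4 (f : ℝ → ℝ → ℝ → ℝ → ℝ) : ℝ → ℝ → ℝ → ℝ → ℝ :=
  fun t x y z => px4 (px4 f) t x y z + py4 (py4 f) t x y z + pz4 (pz4 f) t x y z

/-- The system for six elements of a module over a commutative ring implies the sixth-order equation
for their sum. Here `d` plays the role of `∂/∂t + 4m`, and `a`, `b`, `e` those of `c ∂/∂x`, `c ∂/∂y`,
`c ∂/∂z`. -/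
theorem sixth_order_smul_sum_eq {R M : Type*} [CommRing R] [AddCommGroup M] [Module R M]
    (d a b e m : R) (f0 f1 f2 f3 f4 f5 : M)
    (h0 : (d + a) • f0 = m • (f1 + f2 + f4 + f5)) (h3 : (d - a) • f3 = m • (f1 + f2 + f4 + f5))
    (h1 : (d + b) • f1 = m • (f0 + f2 + f3 + f5)) (h4 : (d - b) • f4 = m • (f0 + f2 + f3 + f5))
    (h2 : (d + e) • f2 = m • (f0 + f1 + f3 + f4)) (h5 : (d - e) • f5 = m • (f0 + f1 + f3 + f4)) :
    (d ^ 6 - 12 * m ^ 2 * d ^ 4 - 16 * m ^ 3 * d ^ 3) • (f0 + f1 + f2 + f3 + f4 + f5) =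
      (a ^ 2 * b ^ 2 * e ^ 2 - d ^ 2 * (a ^ 2 * b ^ 2 + a ^ 2 * e ^ 2 + b ^ 2 * e ^ 2)
        + (d ^ 4 - 4 * m ^ 2 * d ^ 2) * (a ^ 2 + b ^ 2 + e ^ 2)) •
          (f0 + f1 + f2 + f3 + f4 + f5) := by
  have hu : (d ^ 2 - a ^ 2 + 2 * m * d) • (f0 + f3) =
      (2 * m * d) • (f0 + f1 + f2 + f3 + f4 + f5) := by
    linear_combination (norm := module) (d - a) • h0 + (d + a) • h3
  have hv : (d ^ 2 - b ^ 2 + 2 * m * d) • (f1 + f4) =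
      (2 * m * d) • (f0 + f1 + f2 + f3 + f4 + f5) := by
    linear_combination (norm := module) (d - b) • h1 + (d + b) • h4
  have hw : (d ^ 2 - e ^ 2 + 2 * m * d) • (f2 + f5) =
      (2 * m * d) • (f0 + f1 + f2 + f3 + f4 + f5) := by
    linear_combination (norm := module) (d - e) • h2 + (d + e) • h5
  linear_combination (norm := module)
    ((d ^ 2 - b ^ 2 + 2 * m * d) * (d ^ 2 - e ^ 2 + 2 * m * d)) • hu
    + ((d ^ 2 - a ^ 2 + 2 * m * d) * (d ^ 2 - e ^ 2 + 2 * m * d)) • hv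
    + ((d ^ 2 - a ^ 2 + 2 * m * d) * (d ^ 2 - b ^ 2 + 2 * m * d)) • hw

/-- A version of `sixth_order_smul_sum_eq` with real coefficients. -/
theorem sixth_order_smul_real_sum_eq {R M : Type*} [CommRing R] [Algebra ℝ R] [AddCommGroup M]
    [Module ℝ M] [Module R M] [IsScalarTower ℝ R M] (T X Y Z : R) (l c : ℝ)
    (f0 f1 f2 f3 f4 f5 : M)
    (h0 : T • f0 = -c • X • f0 + (l / 4) • (f1 + f2 + f4 + f5 - (4 : ℝ) • f0))
    (h3 : T • f3 = c • X • f3 + (l / 4) • (f1 + f2 + f4 + f5 - (4 : ℝ) • f3))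
    (h1 : T • f1 = -c • Y • f1 + (l / 4) • (f0 + f2 + f3 + f5 - (4 : ℝ) • f1))
    (h4 : T • f4 = c • Y • f4 + (l / 4) • (f0 + f2 + f3 + f5 - (4 : ℝ) • f4))
    (h2 : T • f2 = -c • Z • f2 + (l / 4) • (f0 + f1 + f3 + f4 - (4 : ℝ) • f2))
    (h5 : T • f5 = c • Z • f5 + (l / 4) • (f0 + f1 + f3 + f4 - (4 : ℝ) • f5))
    (p : M) (hp : p = f0 + f1 + f2 + f3 + f4 + f5) :
    (T + algebraMap ℝ R l) ^ 6 • p - (3 * l ^ 2 / 4) • (T + algebraMap ℝ R l) ^ 4 • p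
        - (l ^ 3 / 4) • (T + algebraMap ℝ R l) ^ 3 • p =
      c ^ 6 • X • X • Y • Y • Z • Z • p
        - c ^ 4 • (T + algebraMap ℝ R l) ^ 2 •
          (X • X • Y • Y • p + X • X • Z • Z • p + Y • Y • Z • Z • p)
        + c ^ 2 • ((T + algebraMap ℝ R l) ^ 4 • (X • X • p + Y • Y • p + Z • Z • p)
          - (l ^ 2 / 4) • (T + algebraMap ℝ R l) ^ 2 • (X • X • p + Y • Y • p + Z • Z • p)) := by
  obtain ⟨k, rfl⟩ : ∃ k, l = 4 * k := ⟨l / 4, by ring⟩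
  rw [mul_div_cancel_left₀ k four_ne_zero] at h0 h1 h2 h3 h4 h5
  have key := sixth_order_smul_sum_eq (T + algebraMap ℝ R (4 * k))
    (algebraMap ℝ R c * X) (algebraMap ℝ R c * Y) (algebraMap ℝ R c * Z) (algebraMap ℝ R k)
    f0 f1 f2 f3 f4 f5
    (by linear_combination (norm := module) h0) (by linear_combination (norm := module) h3)
    (by linear_combination (norm := module) h1) (by linear_combination (norm := module) h4)
    (by linear_combination (norm := module) h2) (by linear_combination (norm := module) h5)
  rw [← hp] at key
  rw [show 3 * (4 * k) ^ 2 / 4 = 12 * k ^ 2 by ring, show (4 * k) ^ 3 / 4 = 16 * k ^ 3 by ring,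
    show (4 * k) ^ 2 / 4 = 4 * k ^ 2 by ring]
  have hsmul (r : ℝ) (f : M) : r • f = algebraMap ℝ R r • f := algebra_compatible_smul R r f
  simp only [hsmul, map_mul, map_pow, map_ofNat] at key ⊢
  linear_combination (norm := module) key

open scoped IsMulCommutative in
/-- A version of `sixth_order_smul_sum_eq` for pairwise commuting endomorphisms. -/
theorem sixth_order_apply_sum_eq {M : Type*} [AddCommGroup M] [Module ℝ M]
    (T X Y Z : Module.End ℝ M) (hTX : Commute T X) (hTY : Commute T Y) (hTZ : Commute T Z)
    (hXY : Commute X Y) (hXZ : Commute X Z) (hYZ : Commute Y Z) (l c : ℝ) (f0 f1 f2 f3 f4 f5 : M)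
    (h0 : T f0 = -c • X f0 + (l / 4) • (f1 + f2 + f4 + f5 - (4 : ℝ) • f0))
    (h3 : T f3 = c • X f3 + (l / 4) • (f1 + f2 + f4 + f5 - (4 : ℝ) • f3))
    (h1 : T f1 = -c • Y f1 + (l / 4) • (f0 + f2 + f3 + f5 - (4 : ℝ) • f1))
    (h4 : T f4 = c • Y f4 + (l / 4) • (f0 + f2 + f3 + f5 - (4 : ℝ) • f4))
    (h2 : T f2 = -c • Z f2 + (l / 4) • (f0 + f1 + f3 + f4 - (4 : ℝ) • f2))
    (h5 : T f5 = c • Z f5 + (l / 4) • (f0 + f1 + f3 + f4 - (4 : ℝ) • f5))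
    (D : Module.End ℝ M) (hD : D = T + l • 1) (p : M) (hp : p = f0 + f1 + f2 + f3 + f4 + f5) :
    (D ^ 6) p - (3 * l ^ 2 / 4) • (D ^ 4) p - (l ^ 3 / 4) • (D ^ 3) p =
      c ^ 6 • X (X (Y (Y (Z (Z p)))))
        - c ^ 4 • (D ^ 2) (X (X (Y (Y p))) + X (X (Z (Z p))) + Y (Y (Z (Z p))))
        + c ^ 2 • ((D ^ 4) (X (X p) + Y (Y p) + Z (Z p))
          - (l ^ 2 / 4) • (D ^ 2) (X (X p) + Y (Y p) + Z (Z p))) := by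
  let s : Set (Module.End ℝ M) := {T, X, Y, Z}
  have hs : ∀ u ∈ s, ∀ v ∈ s, u * v = v * u := by
    rintro u (rfl | rfl | rfl | rfl) v (rfl | rfl | rfl | rfl) <;>
      first
        | rfl
        | exact Commute.eq ‹_›
        | exact (Commute.eq ‹_›).symm
  have := Algebra.isMulCommutative_adjoin ℝ hs
  let T' : Algebra.adjoin ℝ s := ⟨T, Algebra.subset_adjoin (by simp [s])⟩
  let X' : Algebra.adjoin ℝ s := ⟨X, Algebra.subset_adjoin (by simp [s])⟩
  let Y' : Algebra.adjoin ℝ s := ⟨Y, Algebra.subset_adjoin (by simp [s])⟩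
  let Z' : Algebra.adjoin ℝ s := ⟨Z, Algebra.subset_adjoin (by simp [s])⟩
  have hD' (n : ℕ) (f : M) : (D ^ n) f = (T' + algebraMap ℝ (Algebra.adjoin ℝ s) l) ^ n • f := by
    rw [hD]
    rfl
  simp only [hD']
  exact sixth_order_smul_real_sum_eq T' X' Y' Z' l c f0 f1 f2 f3 f4 f5 h0 h3 h1 h4 h2 h5 p hp

section DirectionalDerivative

variable {E : Type*} [NormedAddCommGroup E] [NormedSpace ℝ E]

variable (E) in
/-- The space of smooth real-valued functions on `E`. -/
def smoothFunctions : Submodule ℝ (E → ℝ) where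
  carrier := {f | ContDiff ℝ (⊤ : ℕ∞) f}
  add_mem' hf hg := ContDiff.add (Set.mem_ofPred.1 hf) (Set.mem_ofPred.1 hg)
  zero_mem' := Set.mem_ofPred.2 contDiff_zero_fun
  smul_mem' r _ hf := ContDiff.const_smul r (Set.mem_ofPred.1 hf)

namespace smoothFunctions

theorem contDiff (f : smoothFunctions E) : ContDiff ℝ (⊤ : ℕ∞) f.1 := f.2

theorem differentiable (f : smoothFunctions E) : Differentiable ℝ f.1 :=
  (contDiff f).differentiable (by simp)

theorem contDiff_fderiv (f : smoothFunctions E) : ContDiff ℝ (⊤ : ℕ∞) (fderiv ℝ f.1) :=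
  (contDiff f).fderiv_right (by simp)

end smoothFunctions

/-- The derivative in direction `v`, as an endomorphism of the space of smooth functions. -/
noncomputable def dirDeriv (v : E) : Module.End ℝ (smoothFunctions E) where
  toFun f := ⟨fun q => fderiv ℝ f.1 q v,
    (smoothFunctions.contDiff_fderiv f).clm_apply contDiff_const⟩
  map_add' f g := by
    ext q
    change fderiv ℝ (f.1 + g.1) q v = fderiv ℝ f.1 q v + fderiv ℝ g.1 q v
    rw [fderiv_add (smoothFunctions.differentiable f q) (smoothFunctions.differentiable g q)]
    rfl
  map_smul' r f := by
    ext q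
    change fderiv ℝ (r • f.1) q v = r • fderiv ℝ f.1 q v
    rw [fderiv_const_smul (smoothFunctions.differentiable f q)]
    rfl

theorem commute_dirDeriv (v w : E) : Commute (dirDeriv v) (dirDeriv w) := by
  ext f q
  have hd : DifferentiableAt ℝ (fderiv ℝ f.1) q :=
    (smoothFunctions.contDiff_fderiv f).differentiable (by simp) q
  have hv (u : E) : fderiv ℝ (fun q => fderiv ℝ f.1 q u) q = (fderiv ℝ (fderiv ℝ f.1) q).flip u := by
    ext x
    rw [fderiv_clm_apply hd (differentiableAt_const u)]
    simp
  change fderiv ℝ (fun q => fderiv ℝ f.1 q w) q v = fderiv ℝ (fun q => fderiv ℝ f.1 q v) q w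
  rw [hv, hv]
  refine (smoothFunctions.contDiff f).contDiffAt.isSymmSndFDerivAt ?_ v w
  simp only [minSmoothness_of_isRCLikeNormedField]
  exact WithTop.coe_le_coe.2 le_top

theorem dirDeriv_apply_eq_deriv (v : E) (f : smoothFunctions E) (γ : ℝ → E) (s : ℝ)
    (hγ : HasDerivAt γ v s) : deriv (fun r => f.1 (γ r)) s = (dirDeriv v f).1 (γ s) :=
  ((smoothFunctions.differentiable f (γ s)).hasFDerivAt.comp_hasDerivAt s hγ).deriv

end DirectionalDerivative

/-- A smooth function on `ℝ × ℝ × ℝ × ℝ` as a function of four real variables. -/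
def curry4 (f : smoothFunctions (ℝ × ℝ × ℝ × ℝ)) : ℝ → ℝ → ℝ → ℝ → ℝ :=
  fun t x y z => f.1 (t, x, y, z)

theorem pt4_curry4 (f : smoothFunctions (ℝ × ℝ × ℝ × ℝ)) :
    pt4 (curry4 f) = curry4 (dirDeriv (1, 0, 0, 0) f) := by
  ext t x y z
  exact dirDeriv_apply_eq_deriv _ f (fun s => (s, x, y, z)) t
    ((hasDerivAt_id t).prodMk (hasDerivAt_const t _))

theorem px4_curry4 (f : smoothFunctions (ℝ × ℝ × ℝ × ℝ)) :
    px4 (curry4 f) = curry4 (dirDeriv (0, 1, 0, 0) f) := by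
  ext t x y z
  exact dirDeriv_apply_eq_deriv _ f (fun s => (t, s, y, z)) x
    ((hasDerivAt_const x _).prodMk ((hasDerivAt_id x).prodMk (hasDerivAt_const x _)))

theorem py4_curry4 (f : smoothFunctions (ℝ × ℝ × ℝ × ℝ)) :
    py4 (curry4 f) = curry4 (dirDeriv (0, 0, 1, 0) f) := by
  ext t x y z
  exact dirDeriv_apply_eq_deriv _ f (fun s => (t, x, s, z)) y
    ((hasDerivAt_const y _).prodMk ((hasDerivAt_const y _).prodMk
      ((hasDerivAt_id y).prodMk (hasDerivAt_const y _))))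

theorem pz4_curry4 (f : smoothFunctions (ℝ × ℝ × ℝ × ℝ)) :
    pz4 (curry4 f) = curry4 (dirDeriv (0, 0, 0, 1) f) := by
  ext t x y z
  exact dirDeriv_apply_eq_deriv _ f (fun s => (t, x, y, s)) z
    ((hasDerivAt_const z _).prodMk ((hasDerivAt_const z _).prodMk
      ((hasDerivAt_const z _).prodMk (hasDerivAt_id z))))

theorem lap4_curry4 (f : smoothFunctions (ℝ × ℝ × ℝ × ℝ)) :
    lap4 (curry4 f) = curry4 (dirDeriv (0, 1, 0, 0) (dirDeriv (0, 1, 0, 0) f)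
      + dirDeriv (0, 0, 1, 0) (dirDeriv (0, 0, 1, 0) f)
      + dirDeriv (0, 0, 0, 1) (dirDeriv (0, 0, 0, 1) f)) := by
  unfold lap4
  simp only [px4_curry4, py4_curry4, pz4_curry4]
  rfl

theorem iterate_Dop_curry4 (l : ℝ) (n : ℕ) (f : smoothFunctions (ℝ × ℝ × ℝ × ℝ)) :
    (Dop l)^[n] (curry4 f) = curry4 (((dirDeriv (1, 0, 0, 0) + l • 1) ^ n) f) := by
  induction n with
  | zero => rfl
  | succ n ih =>
    rw [Function.iterate_succ_apply', ih, pow_succ', Module.End.mul_apply]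
    unfold Dop
    rw [pt4_curry4]
    rfl

theorem sixth_order_equation_OSM
    (lam c : ℝ) (hlam : 0 < lam) (hc : 0 < c)
    (f0 f1 f2 f3 f4 f5 : ℝ → ℝ → ℝ → ℝ → ℝ)
    (hf0 : ContDiff ℝ (⊤ : ℕ∞) (fun p : ℝ × ℝ × ℝ × ℝ => f0 p.1 p.2.1 p.2.2.1 p.2.2.2))
    (hf1 : ContDiff ℝ (⊤ : ℕ∞) (fun p : ℝ × ℝ × ℝ × ℝ => f1 p.1 p.2.1 p.2.2.1 p.2.2.2))
    (hf2 : ContDiff ℝ (⊤ : ℕ∞) (fun p : ℝ × ℝ × ℝ × ℝ => f2 p.1 p.2.1 p.2.2.1 p.2.2.2))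
    (hf3 : ContDiff ℝ (⊤ : ℕ∞) (fun p : ℝ × ℝ × ℝ × ℝ => f3 p.1 p.2.1 p.2.2.1 p.2.2.2))
    (hf4 : ContDiff ℝ (⊤ : ℕ∞) (fun p : ℝ × ℝ × ℝ × ℝ => f4 p.1 p.2.1 p.2.2.1 p.2.2.2))
    (hf5 : ContDiff ℝ (⊤ : ℕ∞) (fun p : ℝ × ℝ × ℝ × ℝ => f5 p.1 p.2.1 p.2.2.1 p.2.2.2))
    (heq0 : ∀ t x y z, pt4 f0 t x y z =
      -c * px4 f0 t x y z + (lam / 4) *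
        (f1 t x y z + f2 t x y z + f4 t x y z + f5 t x y z - 4 * f0 t x y z))
    (heq3 : ∀ t x y z, pt4 f3 t x y z =
      c * px4 f3 t x y z + (lam / 4) *
        (f1 t x y z + f2 t x y z + f4 t x y z + f5 t x y z - 4 * f3 t x y z))
    (heq1 : ∀ t x y z, pt4 f1 t x y z =
      -c * py4 f1 t x y z + (lam / 4) *
        (f0 t x y z + f2 t x y z + f3 t x y z + f5 t x y z - 4 * f1 t x y z))
    (heq4 : ∀ t x y z, pt4 f4 t x y z =
      c * py4 f4 t x y z + (lam / 4) *
        (f0 t x y z + f2 t x y z + f3 t x y z + f5 t x y z - 4 * f4 t x y z))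
    (heq2 : ∀ t x y z, pt4 f2 t x y z =
      -c * pz4 f2 t x y z + (lam / 4) *
        (f0 t x y z + f1 t x y z + f3 t x y z + f4 t x y z - 4 * f2 t x y z))
    (heq5 : ∀ t x y z, pt4 f5 t x y z =
      c * pz4 f5 t x y z + (lam / 4) *
        (f0 t x y z + f1 t x y z + f3 t x y z + f4 t x y z - 4 * f5 t x y z))
    (p : ℝ → ℝ → ℝ → ℝ → ℝ)
    (hp : p = fun t x y z =>
      f0 t x y z + f1 t x y z + f2 t x y z + f3 t x y z + f4 t x y z + f5 t x y z) :
    ∀ t x y z,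
      (Dop lam)^[6] p t x y z - (3 * lam ^ 2 / 4) * (Dop lam)^[4] p t x y z
        - (lam ^ 3 / 4) * (Dop lam)^[3] p t x y z
      = c ^ 6 * px4 (px4 (py4 (py4 (pz4 (pz4 p))))) t x y z
        - c ^ 4 * (Dop lam)^[2]
            (fun t x y z => px4 (px4 (py4 (py4 p))) t x y z
              + px4 (px4 (pz4 (pz4 p))) t x y z
              + py4 (py4 (pz4 (pz4 p))) t x y z) t x y z
        + c ^ 2 * ((Dop lam)^[4] (lap4 p) t x y z
            - (lam ^ 2 / 4) * (Dop lam)^[2] (lap4 p) t x y z) := by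
  obtain ⟨F0, rfl⟩ : ∃ F, f0 = curry4 F := ⟨⟨_, hf0⟩, rfl⟩
  obtain ⟨F1, rfl⟩ : ∃ F, f1 = curry4 F := ⟨⟨_, hf1⟩, rfl⟩
  obtain ⟨F2, rfl⟩ : ∃ F, f2 = curry4 F := ⟨⟨_, hf2⟩, rfl⟩
  obtain ⟨F3, rfl⟩ : ∃ F, f3 = curry4 F := ⟨⟨_, hf3⟩, rfl⟩
  obtain ⟨F4, rfl⟩ : ∃ F, f4 = curry4 F := ⟨⟨_, hf4⟩, rfl⟩
  obtain ⟨F5, rfl⟩ : ∃ F, f5 = curry4 F := ⟨⟨_, hf5⟩, rfl⟩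
  simp only [pt4_curry4, px4_curry4, py4_curry4, pz4_curry4] at heq0 heq1 heq2 heq3 heq4 heq5
  have key := sixth_order_apply_sum_eq _ _ _ _
    (commute_dirDeriv (1, 0, 0, 0) (0, 1, 0, 0)) (commute_dirDeriv (1, 0, 0, 0) (0, 0, 1, 0))
    (commute_dirDeriv (1, 0, 0, 0) (0, 0, 0, 1)) (commute_dirDeriv (0, 1, 0, 0) (0, 0, 1, 0))
    (commute_dirDeriv (0, 1, 0, 0) (0, 0, 0, 1)) (commute_dirDeriv (0, 0, 1, 0) (0, 0, 0, 1))
    lam c F0 F1 F2 F3 F4 F5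
    (by ext ⟨t, x, y, z⟩; exact heq0 t x y z) (by ext ⟨t, x, y, z⟩; exact heq3 t x y z)
    (by ext ⟨t, x, y, z⟩; exact heq1 t x y z) (by ext ⟨t, x, y, z⟩; exact heq4 t x y z)
    (by ext ⟨t, x, y, z⟩; exact heq2 t x y z) (by ext ⟨t, x, y, z⟩; exact heq5 t x y z) _ rfl _ rfl
  replace hp : p = curry4 (F0 + F1 + F2 + F3 + F4 + F5) := hp
  have curry4_add₃ (A B C : smoothFunctions (ℝ × ℝ × ℝ × ℝ)) :
      (fun t x y z => curry4 A t x y z + curry4 B t x y z + curry4 C t x y z) =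
        curry4 (A + B + C) := rfl
  intro t x y z
  simp only [hp, lap4_curry4, px4_curry4, py4_curry4, pz4_curry4, curry4_add₃, iterate_Dop_curry4]
  exact congrFun (congrArg Subtype.val key) (t, x, y, z)
end

section
/- Let λ, c > 0 be real constants and let q : ℝ⁴ → ℝ be a smooth (C^∞) function of (t,x,y,z), and define p(t,x,y,z) = e^{−λt} q(t,x,y,z). Then p satisfies the sixth-order equation (∂/∂t+λ)⁶ p − (3λ²/4)(∂/∂t+λ)⁴ p − (λ³/4)(∂/∂t+λ)³ p = c⁶ ∂⁶p/(∂x²∂y²∂z²) − c⁴ (∂/∂t+λ)² (∂⁴p/(∂x²∂y²) + ∂⁴p/(∂x²∂z²) + ∂⁴p/(∂y²∂z²)) + c² [(∂/∂t+λ)⁴ − (λ²/4)(∂/∂t+λ)²] Δp if and only if q satisfies (3λ²/4) ∂²/∂t² (∂²q/∂t² + (λ/3) ∂q/∂t − (c²/3) Δq) = (∂²/∂t² − c² ∂²/∂x²)(∂²/∂t² − c² ∂²/∂y²)(∂²/∂t² − c² ∂²/∂z²) q, where Δ = ∂²/∂x² + ∂²/∂y² + ∂²/∂z² is the spatial Laplace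 operator. -/
/-- The D'Alembert operator ∂²/∂t² − c² ∂²/∂x² (for a given spatial partial derivative). -/
noncomputable def dAlembert (c : ℝ) (pd : (ℝ → ℝ → ℝ → ℝ → ℝ) → (ℝ → ℝ → ℝ → ℝ → ℝ))
    (f : ℝ → ℝ → ℝ → ℝ → ℝ) : ℝ → ℝ → ℝ → ℝ → ℝ :=
  fun t x y z => pt4 (pt4 f) t x y z - c ^ 2 * pd (pd f) t x y z

open scoped ContDiff

/-- The space of smooth real functions on `ℝ⁴`. -/
def smoothFn : Submodule ℝ (ℝ × ℝ × ℝ × ℝ → ℝ) where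
  carrier := {F | ContDiff ℝ ∞ F}
  add_mem' hf hg := by
    simp only [Set.mem_ofPred_eq] at *
    exact hf.add hg
  zero_mem' := by
    simp only [Set.mem_ofPred_eq]
    exact contDiff_const (c := (0 : ℝ))
  smul_mem' a _ hf := by
    simp only [Set.mem_ofPred_eq] at *
    exact hf.const_smul a

namespace smoothFn

lemma contDiff (F : smoothFn) : ContDiff ℝ ∞ (F : ℝ × ℝ × ℝ × ℝ → ℝ) := F.2

lemma differentiable (F : smoothFn) : Differentiable ℝ (F : ℝ × ℝ × ℝ × ℝ → ℝ) :=
  (contDiff F).differentiable (by simp)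

/-- The derivative of a smooth function in a fixed direction. -/
noncomputable def dirDeriv (v : ℝ × ℝ × ℝ × ℝ) : smoothFn →ₗ[ℝ] smoothFn where
  toFun F := ⟨fun u => fderiv ℝ (F : ℝ × ℝ × ℝ × ℝ → ℝ) u v,
    ((contDiff F).fderiv_right (m := ∞) (by simp)).clm_apply contDiff_const⟩
  map_add' F G := by
    ext u
    simp [fderiv_add (differentiable F u) (differentiable G u)]
  map_smul' a F := by
    ext u
    simp [fderiv_const_smul (differentiable F u)]

lemma dirDeriv_apply (v u : ℝ × ℝ × ℝ × ℝ) (F : smoothFn) :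
    (dirDeriv v F : ℝ × ℝ × ℝ × ℝ → ℝ) u = fderiv ℝ (F : ℝ × ℝ × ℝ × ℝ → ℝ) u v := rfl

lemma dirDeriv_comm (v w : ℝ × ℝ × ℝ × ℝ) (F : smoothFn) :
    dirDeriv v (dirDeriv w F) = dirDeriv w (dirDeriv v F) := by
  ext u
  have hd : DifferentiableAt ℝ (fderiv ℝ (F : ℝ × ℝ × ℝ × ℝ → ℝ)) u :=
    ((contDiff F).fderiv_right (m := ∞) (by simp)).differentiable (by simp) u
  have key : ∀ a b : ℝ × ℝ × ℝ × ℝ, (dirDeriv a (dirDeriv b F) : ℝ × ℝ × ℝ × ℝ → ℝ) u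
      = fderiv ℝ (fderiv ℝ (F : ℝ × ℝ × ℝ × ℝ → ℝ)) u a b := by
    intro a b
    change fderiv ℝ (fun u' => fderiv ℝ (F : ℝ × ℝ × ℝ × ℝ → ℝ) u' b) u a = _
    rw [fderiv_clm_apply hd (differentiableAt_const b)]
    simp
  rw [key, key]
  exact ((contDiff F).contDiffAt.isSymmSndFDerivAt (by
    simpa using WithTop.coe_le_coe.2 (le_top : (2 : ℕ∞) ≤ ⊤))).eq v w

/-- Multiplication of a smooth function by `e^{-λt}`. -/
noncomputable def expMul (lam : ℝ) : smoothFn →ₗ[ℝ] smoothFn where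
  toFun F := ⟨fun u => Real.exp (-lam * u.1) * (F : ℝ × ℝ × ℝ × ℝ → ℝ) u,
    (contDiff_const.mul contDiff_fst).exp.mul (contDiff F)⟩
  map_add' F G := by
    ext u
    simp [mul_add]
  map_smul' a F := by
    ext u
    simp [mul_left_comm]

lemma expMul_apply (lam : ℝ) (u : ℝ × ℝ × ℝ × ℝ) (F : smoothFn) :
    (expMul lam F : ℝ × ℝ × ℝ × ℝ → ℝ) u
      = Real.exp (-lam * u.1) * (F : ℝ × ℝ × ℝ × ℝ → ℝ) u := rfl

lemma dirDeriv_expMul (lam : ℝ) (v : ℝ × ℝ × ℝ × ℝ) (F : smoothFn) :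
    dirDeriv v (expMul lam F) = expMul lam (dirDeriv v F - (lam * v.1) • F) := by
  ext u
  have h1 : HasFDerivAt (fun u : ℝ × ℝ × ℝ × ℝ => Real.exp (-lam * u.1))
      (Real.exp (-lam * u.1) • (-lam) • ContinuousLinearMap.fst ℝ ℝ (ℝ × ℝ × ℝ)) u :=
    (hasFDerivAt_fst.const_mul (-lam)).exp
  have h2 := h1.mul (differentiable F u).hasFDerivAt
  have h3 : (dirDeriv v (expMul lam F) : ℝ × ℝ × ℝ × ℝ → ℝ) u = _ :=
    congrArg (fun L => L v) h2.fderiv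
  rw [h3, expMul_apply]
  simp [dirDeriv_apply]
  ring

/-- A smooth function on `ℝ⁴` as a function of four real variables. -/
def curry (F : smoothFn) : ℝ → ℝ → ℝ → ℝ → ℝ :=
  fun t x y z => (F : ℝ × ℝ × ℝ × ℝ → ℝ) (t, x, y, z)

/-- The partial derivative in the time variable. -/
noncomputable abbrev dt : smoothFn →ₗ[ℝ] smoothFn := dirDeriv (1, 0, 0, 0)

/-- The partial derivative in the `x` variable. -/
noncomputable abbrev dx : smoothFn →ₗ[ℝ] smoothFn := dirDeriv (0, 1, 0, 0)

/-- The partial derivative in the `y` variable. -/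
noncomputable abbrev dy : smoothFn →ₗ[ℝ] smoothFn := dirDeriv (0, 0, 1, 0)

/-- The partial derivative in the `z` variable. -/
noncomputable abbrev dz : smoothFn →ₗ[ℝ] smoothFn := dirDeriv (0, 0, 0, 1)

lemma pt4_curry (F : smoothFn) : pt4 (curry F) = curry (dt F) := by
  funext t x y z
  exact ((differentiable F (t, x, y, z)).hasFDerivAt.comp_hasDerivAt t
    ((hasDerivAt_id t).prodMk (hasDerivAt_const t (x, y, z)))).deriv

lemma px4_curry (F : smoothFn) : px4 (curry F) = curry (dx F) := by
  funext t x y z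
  exact ((differentiable F (t, x, y, z)).hasFDerivAt.comp_hasDerivAt x
    ((hasDerivAt_const x t).prodMk
      ((hasDerivAt_id x).prodMk (hasDerivAt_const x (y, z))))).deriv

lemma py4_curry (F : smoothFn) : py4 (curry F) = curry (dy F) := by
  funext t x y z
  exact ((differentiable F (t, x, y, z)).hasFDerivAt.comp_hasDerivAt y
    ((hasDerivAt_const y t).prodMk ((hasDerivAt_const y x).prodMk
      ((hasDerivAt_id y).prodMk (hasDerivAt_const y z))))).deriv

lemma pz4_curry (F : smoothFn) : pz4 (curry F) = curry (dz F) := by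
  funext t x y z
  exact ((differentiable F (t, x, y, z)).hasFDerivAt.comp_hasDerivAt z
    ((hasDerivAt_const z t).prodMk ((hasDerivAt_const z x).prodMk
      ((hasDerivAt_const z y).prodMk (hasDerivAt_id z))))).deriv

lemma curry_add (F G : smoothFn) :
    curry (F + G) = fun t x y z => curry F t x y z + curry G t x y z := rfl

lemma curry_sub (F G : smoothFn) :
    curry (F - G) = fun t x y z => curry F t x y z - curry G t x y z := rfl

lemma curry_smul (a : ℝ) (F : smoothFn) :
    curry (a • F) = fun t x y z => a * curry F t x y z := rfl

lemma curry_expMul (lam : ℝ) (F : smoothFn) :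
    curry (expMul lam F) = fun t x y z => Real.exp (-lam * t) * curry F t x y z := rfl

lemma Dop_curry_expMul (lam : ℝ) (F : smoothFn) :
    Dop lam (curry (expMul lam F)) = curry (expMul lam (dt F)) := by
  have h : Dop lam (curry (expMul lam F)) = curry (dt (expMul lam F) + lam • expMul lam F) := by
    unfold Dop
    rw [pt4_curry]
    rfl
  rw [h, dirDeriv_expMul]
  simp

lemma Dop_iterate_curry_expMul (lam : ℝ) (n : ℕ) (F : smoothFn) :
    (Dop lam)^[n] (curry (expMul lam F)) = curry (expMul lam (dt^[n] F)) := by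
  induction n generalizing F with
  | zero => rfl
  | succ n ih => rw [Function.iterate_succ_apply, Function.iterate_succ_apply,
      Dop_curry_expMul, ih]

lemma lap4_curry (F : smoothFn) :
    lap4 (curry F) = curry (dx (dx F) + dy (dy F) + dz (dz F)) := by
  funext t x y z
  simp only [lap4, px4_curry, py4_curry, pz4_curry, curry_add]

lemma dAlembert_curry (c : ℝ) {pd : (ℝ → ℝ → ℝ → ℝ → ℝ) → (ℝ → ℝ → ℝ → ℝ → ℝ)}
    {d : smoothFn →ₗ[ℝ] smoothFn} (hd : ∀ F, pd (curry F) = curry (d F)) (F : smoothFn) :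
    dAlembert c pd (curry F) = curry (dt (dt F) - c ^ 2 • d (d F)) := by
  funext t x y z
  simp only [dAlembert, pt4_curry, hd, curry_sub, curry_smul]

end smoothFn

open smoothFn

theorem exponential_transformation_sixth_order
    (lam c : ℝ) (hlam : 0 < lam) (hc : 0 < c)
    (q : ℝ → ℝ → ℝ → ℝ → ℝ)
    (hq : ContDiff ℝ (⊤ : ℕ∞) (fun p : ℝ × ℝ × ℝ × ℝ => q p.1 p.2.1 p.2.2.1 p.2.2.2))
    (p : ℝ → ℝ → ℝ → ℝ → ℝ)
    (hp : p = fun t x y z => Real.exp (-lam * t) * q t x y z) :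
    (∀ t x y z,
      (Dop lam)^[6] p t x y z - (3 * lam ^ 2 / 4) * (Dop lam)^[4] p t x y z
        - (lam ^ 3 / 4) * (Dop lam)^[3] p t x y z
      = c ^ 6 * px4 (px4 (py4 (py4 (pz4 (pz4 p))))) t x y z
        - c ^ 4 * (Dop lam)^[2]
            (fun t x y z => px4 (px4 (py4 (py4 p))) t x y z
              + px4 (px4 (pz4 (pz4 p))) t x y z
              + py4 (py4 (pz4 (pz4 p))) t x y z) t x y z
        + c ^ 2 * ((Dop lam)^[4] (lap4 p) t x y z
            - (lam ^ 2 / 4) * (Dop lam)^[2] (lap4 p) t x y z))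
    ↔
    (∀ t x y z,
      (3 * lam ^ 2 / 4) * pt4 (pt4 (fun t x y z =>
          pt4 (pt4 q) t x y z + (lam / 3) * pt4 q t x y z
            - (c ^ 2 / 3) * lap4 q t x y z)) t x y z
      = dAlembert c px4 (dAlembert c py4 (dAlembert c pz4 q)) t x y z) := by
  obtain ⟨Q, rfl⟩ : ∃ Q : smoothFn, q = curry Q :=
    ⟨⟨fun u => q u.1 u.2.1 u.2.2.1 u.2.2.2, hq⟩, rfl⟩
  rw [← curry_expMul] at hp
  subst hp
  have hx (F : smoothFn) : dx (expMul lam F) = expMul lam (dx F) := by simp [dirDeriv_expMul]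
  have hy (F : smoothFn) : dy (expMul lam F) = expMul lam (dy F) := by simp [dirDeriv_expMul]
  have hz (F : smoothFn) : dz (expMul lam F) = expMul lam (dz F) := by simp [dirDeriv_expMul]
  have cx (F : smoothFn) : dx (dt F) = dt (dx F) := dirDeriv_comm _ _ _
  have cy (F : smoothFn) : dy (dt F) = dt (dy F) := dirDeriv_comm _ _ _
  have hs (F G H : smoothFn) : (fun t x y z =>
      curry F t x y z + curry G t x y z + curry H t x y z) = curry (F + G + H) := rfl
  have hl (a b : ℝ) (F G H : smoothFn) : (fun t x y z =>
      curry F t x y z + a * curry G t x y z - b * curry H t x y z)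
      = curry (F + a • G - b • H) := rfl
  simp only [lap4_curry, px4_curry, py4_curry, pz4_curry, hx, hy, hz, ← map_add, hs, hl,
    pt4_curry, Dop_iterate_curry_expMul,
    dAlembert_curry c px4_curry, dAlembert_curry c py4_curry, dAlembert_curry c pz4_curry]
  refine forall₄_congr fun t x y z => ?_
  simp only [curry_expMul, Function.iterate_succ_apply, Function.iterate_zero_apply, map_add,
    map_sub, map_smul, cx, cy, curry_add, curry_sub, curry_smul]
  constructor
  · intro h
    refine mul_left_cancel₀ (Real.exp_pos (-lam * t)).ne' ?_
    linear_combination -h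
  · intro h
    linear_combination -Real.exp (-lam * t) * h
end

section
/- Let c > 0, let λ : ℝ → ℝ be continuous with antiderivative Λ (Λ' = λ), and let f₀, f₁, f₃, f₄ : ℝ³ → ℝ be continuously differentiable functions of (t,x,y) satisfying: ∂f₀/∂t = −c ∂f₀/∂x + (λ(t)/4)(f₁+f₄−4f₀); ∂f₃/∂t = c ∂f₃/∂x + (λ(t)/4)(f₁+f₄−4f₃); ∂f₁/∂t = −c ∂f₁/∂y + (λ(t)/4)(f₀+f₃−4f₁); ∂f₄/∂t = c ∂f₄/∂y + (λ(t)/4)(f₀+f₃−4f₄). Define qᵢ(t,x,y) = (3/2) e^{Λ(t)/2} fᵢ(t,x,y) for i ∈ {0,1,3,4}. Then the qᵢ satisfy: ∂q₀/∂t = −c ∂q₀/∂x + (λ(t)/4)(q₁+q₄−2q₀); ∂q₁/∂t = −c ∂q₁/∂y + (λ(t)/4)(q₀+q₃−2q₁); ∂q₃/∂t = c ∂q₃/∂x + (λ(t)/4)(q₁+q₄−2q₃); ∂q₄/∂t = c ∂q₄/∂y + (λ(t)/4)(q₀+q₃−2q₄). -/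
/-- Partial derivative in the first (time) variable of a function of three real variables. -/
noncomputable def pt3 (f : ℝ → ℝ → ℝ → ℝ) : ℝ → ℝ → ℝ → ℝ :=
  fun t x y => deriv (fun s => f s x y) t

/-- Partial derivative in the second (x) variable. -/
noncomputable def px3 (f : ℝ → ℝ → ℝ → ℝ) : ℝ → ℝ → ℝ → ℝ :=
  fun t x y => deriv (fun s => f t s y) x

/-- Partial derivative in the third (y) variable. -/
noncomputable def py3 (f : ℝ → ℝ → ℝ → ℝ) : ℝ → ℝ → ℝ → ℝ :=
  fun t x y => deriv (fun s => f t x s) y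

/-- Product rule in time for a function multiplied by the integrating factor `k * exp (L / 2)`. -/
theorem pt3_const_mul_exp_half_mul {L : ℝ → ℝ} {l t : ℝ} (hL : HasDerivAt L l t) (k : ℝ)
    {f : ℝ → ℝ → ℝ → ℝ} (hf : ContDiff ℝ 1 (fun p : ℝ × ℝ × ℝ => f p.1 p.2.1 p.2.2)) (x y : ℝ) :
    pt3 (fun t x y => k * Real.exp (L t / 2) * f t x y) t x y =
      k * Real.exp (L t / 2) * (pt3 f t x y + l / 2 * f t x y) := by
  have hd : DifferentiableAt ℝ (fun s => f s x y) t :=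
    ((hf.differentiable one_ne_zero).comp (g := fun p : ℝ × ℝ × ℝ => f p.1 p.2.1 p.2.2)
      (f := fun s : ℝ => (s, x, y)) (by fun_prop)) t
  have h := (((hL.div_const 2).exp.const_mul k).mul hd.hasDerivAt).deriv
  unfold pt3
  refine h.trans ?_
  ring

theorem px3_mul_left (g : ℝ → ℝ) (f : ℝ → ℝ → ℝ → ℝ) (t x y : ℝ) :
    px3 (fun t x y => g t * f t x y) t x y = g t * px3 f t x y :=
  deriv_const_mul_field _

theorem py3_mul_left (g : ℝ → ℝ) (f : ℝ → ℝ → ℝ → ℝ) (t x y : ℝ) :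
    py3 (fun t x y => g t * f t x y) t x y = g t * py3 f t x y :=
  deriv_const_mul_field _

theorem motion_on_xy_plane_system
    (c : ℝ) (hc : 0 < c)
    (lam Lam : ℝ → ℝ) (hlam : Continuous lam)
    (hLam : ∀ t, HasDerivAt Lam (lam t) t)
    (f0 f1 f3 f4 : ℝ → ℝ → ℝ → ℝ)
    (hf0 : ContDiff ℝ 1 (fun p : ℝ × ℝ × ℝ => f0 p.1 p.2.1 p.2.2))
    (hf1 : ContDiff ℝ 1 (fun p : ℝ × ℝ × ℝ => f1 p.1 p.2.1 p.2.2))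
    (hf3 : ContDiff ℝ 1 (fun p : ℝ × ℝ × ℝ => f3 p.1 p.2.1 p.2.2))
    (hf4 : ContDiff ℝ 1 (fun p : ℝ × ℝ × ℝ => f4 p.1 p.2.1 p.2.2))
    (heq0 : ∀ t x y, pt3 f0 t x y =
      -c * px3 f0 t x y + (lam t / 4) * (f1 t x y + f4 t x y - 4 * f0 t x y))
    (heq3 : ∀ t x y, pt3 f3 t x y =
      c * px3 f3 t x y + (lam t / 4) * (f1 t x y + f4 t x y - 4 * f3 t x y))
    (heq1 : ∀ t x y, pt3 f1 t x y =
      -c * py3 f1 t x y + (lam t / 4) * (f0 t x y + f3 t x y - 4 * f1 t x y))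
    (heq4 : ∀ t x y, pt3 f4 t x y =
      c * py3 f4 t x y + (lam t / 4) * (f0 t x y + f3 t x y - 4 * f4 t x y))
    (q0 q1 q3 q4 : ℝ → ℝ → ℝ → ℝ)
    (hq0 : q0 = fun t x y => (3 / 2) * Real.exp (Lam t / 2) * f0 t x y)
    (hq1 : q1 = fun t x y => (3 / 2) * Real.exp (Lam t / 2) * f1 t x y)
    (hq3 : q3 = fun t x y => (3 / 2) * Real.exp (Lam t / 2) * f3 t x y)
    (hq4 : q4 = fun t x y => (3 / 2) * Real.exp (Lam t / 2) * f4 t x y) :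
    (∀ t x y, pt3 q0 t x y =
      -c * px3 q0 t x y + (lam t / 4) * (q1 t x y + q4 t x y - 2 * q0 t x y)) ∧
    (∀ t x y, pt3 q1 t x y =
      -c * py3 q1 t x y + (lam t / 4) * (q0 t x y + q3 t x y - 2 * q1 t x y)) ∧
    (∀ t x y, pt3 q3 t x y =
      c * px3 q3 t x y + (lam t / 4) * (q1 t x y + q4 t x y - 2 * q3 t x y)) ∧
    (∀ t x y, pt3 q4 t x y =
      c * py3 q4 t x y + (lam t / 4) * (q0 t x y + q3 t x y - 2 * q4 t x y)) := by
  subst hq0 hq1 hq3 hq4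
  refine ⟨fun t x y => ?_, fun t x y => ?_, fun t x y => ?_, fun t x y => ?_⟩
  · rw [pt3_const_mul_exp_half_mul (hLam t) _ hf0, heq0,
      px3_mul_left (fun t => 3 / 2 * Real.exp (Lam t / 2))]
    ring
  · rw [pt3_const_mul_exp_half_mul (hLam t) _ hf1, heq1,
      py3_mul_left (fun t => 3 / 2 * Real.exp (Lam t / 2))]
    ring
  · rw [pt3_const_mul_exp_half_mul (hLam t) _ hf3, heq3,
      px3_mul_left (fun t => 3 / 2 * Real.exp (Lam t / 2))]
    ring
  · rw [pt3_const_mul_exp_half_mul (hLam t) _ hf4, heq4,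
      py3_mul_left (fun t => 3 / 2 * Real.exp (Lam t / 2))]
    ring
end

section
/- Let λ : ℝ → ℝ be continuous and let f₀, f₁ : ℝ² → ℝ be twice continuously differentiable functions of (t,s) satisfying: ∂f₀/∂t = −(λ(t)/2) f₀ + λ(t) f₁ and ∂f₁/∂t = −∂f₁/∂s + (λ(t)/2)(f₀ − 2 f₁). Then p = f₀ + f₁ satisfies the second-order equation ∂²p/∂t² + ∂²p/(∂t∂s) + (3λ(t)/2) ∂p/∂t + (λ(t)/2) ∂p/∂s = 0. -/
/-- Partial derivative in the first (time) variable of a function of two real variables. -/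
noncomputable def pt2 (f : ℝ → ℝ → ℝ) : ℝ → ℝ → ℝ :=
  fun t s => deriv (fun u => f u s) t

/-- Partial derivative in the second (s) variable. -/
noncomputable def ps2 (f : ℝ → ℝ → ℝ) : ℝ → ℝ → ℝ :=
  fun t s => deriv (fun u => f t u) s

/-- The derivative in the first variable is the Fréchet derivative in the direction `(1, 0)`. -/
theorem hasDerivAt_fst_of_differentiable {F : ℝ × ℝ → ℝ} (hF : Differentiable ℝ F) (t s : ℝ) :
    HasDerivAt (fun u => F (u, s)) (fderiv ℝ F (t, s) (1, 0)) t :=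
  (hF (t, s)).hasFDerivAt.comp_hasDerivAt t ((hasDerivAt_id t).prodMk (hasDerivAt_const t s))

/-- The derivative in the second variable is the Fréchet derivative in the direction `(0, 1)`. -/
theorem hasDerivAt_snd_of_differentiable {F : ℝ × ℝ → ℝ} (hF : Differentiable ℝ F) (t s : ℝ) :
    HasDerivAt (fun u => F (t, u)) (fderiv ℝ F (t, s) (0, 1)) s :=
  (hF (t, s)).hasFDerivAt.comp_hasDerivAt s ((hasDerivAt_const s t).prodMk (hasDerivAt_id s))

theorem pt2_eq_fderiv {f : ℝ → ℝ → ℝ} (hf : Differentiable ℝ (fun p : ℝ × ℝ => f p.1 p.2)) :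
    pt2 f = fun t s => fderiv ℝ (fun p : ℝ × ℝ => f p.1 p.2) (t, s) (1, 0) := by
  funext t s
  exact (hasDerivAt_fst_of_differentiable hf t s).deriv

theorem ps2_eq_fderiv {f : ℝ → ℝ → ℝ} (hf : Differentiable ℝ (fun p : ℝ × ℝ => f p.1 p.2)) :
    ps2 f = fun t s => fderiv ℝ (fun p : ℝ × ℝ => f p.1 p.2) (t, s) (0, 1) := by
  funext t s
  exact (hasDerivAt_snd_of_differentiable hf t s).deriv

theorem differentiable_fderiv_apply_of_contDiff_two {F : ℝ × ℝ → ℝ} (hF : ContDiff ℝ 2 F)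
    (v : ℝ × ℝ) : Differentiable ℝ (fun q => fderiv ℝ F q v) :=
  ((hF.fderiv_right (m := 1) (by norm_num)).differentiable (by norm_num)).clm_apply
    (differentiable_const v)

theorem differentiableAt_ps2 {f : ℝ → ℝ → ℝ}
    (hf : ContDiff ℝ 2 (fun p : ℝ × ℝ => f p.1 p.2)) (t s : ℝ) :
    DifferentiableAt ℝ (fun u => ps2 f u s) t := by
  rw [ps2_eq_fderiv (hf.differentiable (by norm_num))]
  exact (hasDerivAt_fst_of_differentiable
    (differentiable_fderiv_apply_of_contDiff_two hf (0, 1)) t s).differentiableAt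

/-- Symmetry of the mixed second partial derivatives of a `C²` function. -/
theorem pt2_ps2_comm {f : ℝ → ℝ → ℝ} (hf : ContDiff ℝ 2 (fun p : ℝ × ℝ => f p.1 p.2))
    (t s : ℝ) : pt2 (ps2 f) t s = ps2 (pt2 f) t s := by
  have hd := hf.differentiable (by norm_num)
  have hd' : DifferentiableAt ℝ (fderiv ℝ (fun p : ℝ × ℝ => f p.1 p.2)) (t, s) :=
    (hf.fderiv_right (m := 1) (by norm_num)).differentiable (by norm_num) (t, s)
  have hsymm : IsSymmSndFDerivAt ℝ (fun p : ℝ × ℝ => f p.1 p.2) (t, s) :=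
    hf.contDiffAt.isSymmSndFDerivAt (by simp)
  rw [ps2_eq_fderiv hd, pt2_eq_fderiv hd,
    pt2_eq_fderiv (differentiable_fderiv_apply_of_contDiff_two hf (0, 1)),
    ps2_eq_fderiv (differentiable_fderiv_apply_of_contDiff_two hf (1, 0))]
  simp only [Prod.mk.eta]
  rw [fderiv_clm_apply hd' (differentiableAt_const _),
    fderiv_clm_apply hd' (differentiableAt_const _)]
  simpa using hsymm.eq (1, 0) (0, 1)

theorem time_along_z_axis_equation
    (lam : ℝ → ℝ) (hlam : Continuous lam)
    (f0 f1 : ℝ → ℝ → ℝ)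
    (hf0 : ContDiff ℝ 2 (fun p : ℝ × ℝ => f0 p.1 p.2))
    (hf1 : ContDiff ℝ 2 (fun p : ℝ × ℝ => f1 p.1 p.2))
    (heq0 : ∀ t s, pt2 f0 t s = -(lam t / 2) * f0 t s + lam t * f1 t s)
    (heq1 : ∀ t s, pt2 f1 t s = -ps2 f1 t s + (lam t / 2) * (f0 t s - 2 * f1 t s))
    (p : ℝ → ℝ → ℝ) (hp : p = fun t s => f0 t s + f1 t s) :
    ∀ t s,
      pt2 (pt2 p) t s + pt2 (ps2 p) t s + (3 * lam t / 2) * pt2 p t s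
        + (lam t / 2) * ps2 p t s = 0 := by
  intro t s
  subst hp
  have hd0 := hf0.differentiable (by norm_num)
  have hd1 := hf1.differentiable (by norm_num)
  have hs0 (t s : ℝ) : DifferentiableAt ℝ (fun u => f0 t u) s :=
    (hasDerivAt_snd_of_differentiable hd0 t s).differentiableAt
  have hs1 (t s : ℝ) : DifferentiableAt ℝ (fun u => f1 t u) s :=
    (hasDerivAt_snd_of_differentiable hd1 t s).differentiableAt
  have hpt : pt2 (fun t s => f0 t s + f1 t s) = fun t s => -ps2 f1 t s := by
    funext t s
    have h : pt2 (fun t s => f0 t s + f1 t s) t s = pt2 f0 t s + pt2 f1 t s :=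
      deriv_fun_add (hasDerivAt_fst_of_differentiable hd0 t s).differentiableAt
        (hasDerivAt_fst_of_differentiable hd1 t s).differentiableAt
    rw [h, heq0, heq1]
    ring
  have hps : ps2 (fun t s => f0 t s + f1 t s) = fun t s => ps2 f0 t s + ps2 f1 t s := by
    funext t s
    exact deriv_fun_add (hs0 t s) (hs1 t s)
  have hptt : pt2 (fun t s => -ps2 f1 t s) t s = -pt2 (ps2 f1) t s := deriv.fun_neg
  have hpts : pt2 (fun t s => ps2 f0 t s + ps2 f1 t s) t s
      = pt2 (ps2 f0) t s + pt2 (ps2 f1) t s :=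
    deriv_fun_add (differentiableAt_ps2 hf0 t s) (differentiableAt_ps2 hf1 t s)
  have hmixed : ps2 (pt2 f0) t s = -(lam t / 2) * ps2 f0 t s + lam t * ps2 f1 t s := by
    have h : pt2 f0 = fun t s => -(lam t / 2) * f0 t s + lam t * f1 t s := by
      funext t s
      exact heq0 t s
    rw [h]
    exact (((hs0 t s).hasDerivAt.const_mul _).add ((hs1 t s).hasDerivAt.const_mul _)).deriv
  rw [hpt, hps, hptt, hpts, pt2_ps2_comm hf0, hmixed]
  ring
end

section
/- For an integer ν ≥ 0, let I_ν denote the modified Bessel function of the first kind, defined by the everywhere-convergent series I_ν(x) = Σ_{k=0}^∞ (x/2)^{2k+ν} / (k! (k+ν)!). Let λ > 0 and define, for 0 < s < t, p(t,s) = (λ/3) e^{−λ(t+s)/2} [2 I₀(λ√(2s(t−s))) + ((2t−s)/√(2s(t−s))) I₁(λ√(2s(t−s)))]. Then p satisfies, at every (t,s) with 0 < s < t, the equation ∂²p/∂t² + ∂²p/(∂t∂s) + (3λ/2) ∂p/∂t + (λ/2) ∂p/∂s = 0. -/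
/-- The modified Bessel function of the first kind of integer order ν,
defined by its everywhere-convergent power series. -/
noncomputable def besselI (ν : ℕ) (x : ℝ) : ℝ :=
  ∑' k : ℕ, (x / 2) ^ (2 * k + ν) / ((Nat.factorial k : ℝ) * (Nat.factorial (k + ν) : ℝ))

/-- The entire function `∑ w ^ k / (k! (k + n)!)`, which satisfies
`I_n x = (x / 2) ^ n * besselClifford n ((x / 2) ^ 2)`. -/
noncomputable def besselClifford (n : ℕ) (w : ℝ) : ℝ :=
  ∑' k : ℕ, w ^ k / ((Nat.factorial k : ℝ) * (Nat.factorial (k + n) : ℝ))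

theorem summable_besselClifford (n : ℕ) (w : ℝ) :
    Summable fun k : ℕ => w ^ k / ((Nat.factorial k : ℝ) * (Nat.factorial (k + n) : ℝ)) := by
  refine Summable.of_norm_bounded (Real.summable_pow_div_factorial |w|) fun k => ?_
  have h : (1 : ℝ) ≤ Nat.factorial (k + n) := by exact_mod_cast Nat.factorial_pos _
  have hk : (0 : ℝ) < Nat.factorial k := by positivity
  rw [norm_div, norm_pow, Real.norm_eq_abs, Real.norm_of_nonneg (by positivity)]
  gcongr
  nlinarith

theorem besselI_eq_besselClifford (n : ℕ) (x : ℝ) :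
    besselI n x = (x / 2) ^ n * besselClifford n ((x / 2) ^ 2) := by
  rw [besselI, besselClifford, ← tsum_mul_left]
  congr 1 with k
  rw [← pow_mul, pow_add]
  ring

theorem hasDerivAt_besselClifford (n : ℕ) (w : ℝ) :
    HasDerivAt (besselClifford n) (besselClifford (n + 1) w) w := by
  set R : ℝ := |w| + 1 with hR
  have hu : Summable fun k : ℕ => (k : ℝ) * R ^ (k - 1) / (Nat.factorial k : ℝ) := by
    rw [← summable_nat_add_iff 1]
    refine (Real.summable_pow_div_factorial R).congr fun k => ?_
    rw [Nat.factorial_succ, Nat.add_sub_cancel]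
    push_cast
    field_simp
  have key := hasDerivAt_tsum_of_isPreconnected (t := Metric.ball (0 : ℝ) R)
    (g := fun (k : ℕ) (y : ℝ) => y ^ k / ((Nat.factorial k : ℝ) * (Nat.factorial (k + n) : ℝ)))
    (g' := fun (k : ℕ) (y : ℝ) =>
      (k : ℝ) * y ^ (k - 1) / ((Nat.factorial k : ℝ) * (Nat.factorial (k + n) : ℝ)))
    (y₀ := 0) (y := w) hu Metric.isOpen_ball (convex_ball _ _).isPreconnected
    (fun k y _ => (hasDerivAt_pow k y).div_const _)
    (fun k y hy => by
      have h : (1 : ℝ) ≤ Nat.factorial (k + n) := by exact_mod_cast Nat.factorial_pos _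
      have hk : (0 : ℝ) < Nat.factorial k := by positivity
      have hyR : |y| ≤ R := by simpa using (Metric.mem_ball.mp hy).le
      rw [norm_div, norm_mul, norm_pow, Real.norm_eq_abs, Real.norm_eq_abs, Nat.abs_cast,
        Real.norm_of_nonneg (by positivity)]
      gcongr
      nlinarith)
    (Metric.mem_ball_self (by positivity)) (summable_besselClifford n 0)
    (by simp [hR])
  have hshift : ∀ k : ℕ, ((k + 1 : ℕ) : ℝ) * w ^ (k + 1 - 1) /
      ((Nat.factorial (k + 1) : ℝ) * (Nat.factorial (k + 1 + n) : ℝ)) =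
      w ^ k / ((Nat.factorial k : ℝ) * (Nat.factorial (k + (n + 1)) : ℝ)) := fun k => by
    rw [Nat.factorial_succ k, Nat.add_sub_cancel, show k + (n + 1) = k + 1 + n by ring]
    push_cast
    field_simp
  refine key.congr_deriv ?_
  rw [Summable.tsum_eq_zero_add, besselClifford]
  · simp only [hshift]
    simp
  · rw [← summable_nat_add_iff 1]
    simp only [hshift]
    exact summable_besselClifford (n + 1) w

theorem besselClifford_recurrence (n : ℕ) (w : ℝ) :
    w * besselClifford (n + 2) w + (n + 1) * besselClifford (n + 1) w = besselClifford n w := by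
  have h1 := summable_besselClifford (n + 1) w
  have h2 := summable_besselClifford (n + 2) w
  have h0 := summable_besselClifford n w
  simp only [besselClifford]
  rw [h0.tsum_eq_zero_add, h1.tsum_eq_zero_add, mul_add, ← tsum_mul_left, ← tsum_mul_left,
    add_left_comm, ← Summable.tsum_add (h2.mul_left _)
      (((summable_nat_add_iff 1).mpr h1).mul_left _)]
  congr 1
  · simp [Nat.factorial_succ]
    field_simp
  · congr 1 with k
    rw [show k + 1 + (n + 1) = (k + n + 1) + 1 by ring, show k + (n + 2) = (k + n + 1) + 1 by ring,
      show k + 1 + n = k + n + 1 by ring, Nat.factorial_succ (k + n + 1), Nat.factorial_succ k]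
    push_cast
    field_simp
    ring

theorem hasDerivAt_besselClifford_comp_fst (n : ℕ) (lam t s : ℝ) :
    HasDerivAt (fun u => besselClifford n (lam ^ 2 * s * (u - s) / 2))
      (besselClifford (n + 1) (lam ^ 2 * s * (t - s) / 2) * (lam ^ 2 * s / 2)) t := by
  have h := ((((hasDerivAt_id' t).sub_const s).const_mul (lam ^ 2 * s)).div_const 2)
  exact ((hasDerivAt_besselClifford n _).comp t h).congr_deriv (by ring)

theorem hasDerivAt_besselClifford_comp_snd (n : ℕ) (lam t s : ℝ) :
    HasDerivAt (fun u => besselClifford n (lam ^ 2 * u * (t - u) / 2))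
      (besselClifford (n + 1) (lam ^ 2 * s * (t - s) / 2) * (lam ^ 2 * (t - 2 * s) / 2)) s := by
  have h := (((hasDerivAt_id' s).const_mul (lam ^ 2)).mul
    ((hasDerivAt_id' s).const_sub t)).div_const 2
  exact ((hasDerivAt_besselClifford n _).comp s h).congr_deriv (by
    simp only [Pi.mul_apply]
    ring)

theorem hasDerivAt_exp_decay_fst (lam t s : ℝ) :
    HasDerivAt (fun u => lam / 3 * Real.exp (-lam * (u + s) / 2))
      (lam / 3 * Real.exp (-lam * (t + s) / 2) * (-lam / 2)) t :=
  (((((hasDerivAt_id' t).add_const s).const_mul (-lam)).div_const 2).exp.const_mul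
    (lam / 3)).congr_deriv (by ring)

theorem hasDerivAt_exp_decay_snd (lam t s : ℝ) :
    HasDerivAt (fun u => lam / 3 * Real.exp (-lam * (t + u) / 2))
      (lam / 3 * Real.exp (-lam * (t + s) / 2) * (-lam / 2)) s :=
  (((((hasDerivAt_id' s).const_add t).const_mul (-lam)).div_const 2).exp.const_mul
    (lam / 3)).congr_deriv (by ring)

/-- Derivative in the first variable of a damped linear combination of Bessel–Clifford functions. -/
theorem hasDerivAt_damped_besselClifford_fst (lam a t s b' c' : ℝ) (b c : ℝ → ℝ)
    (hb : HasDerivAt b b' t) (hc : HasDerivAt c c' t) :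
    HasDerivAt (fun u => lam / 3 * Real.exp (-lam * (u + s) / 2) *
        (a * besselClifford 0 (lam ^ 2 * s * (u - s) / 2)
          + b u * besselClifford 1 (lam ^ 2 * s * (u - s) / 2)
          + c u * besselClifford 2 (lam ^ 2 * s * (u - s) / 2)))
      (lam / 3 * Real.exp (-lam * (t + s) / 2) *
        (-lam / 2 * a * besselClifford 0 (lam ^ 2 * s * (t - s) / 2)
          + (a * (lam ^ 2 * s / 2) + b' - lam / 2 * b t)
            * besselClifford 1 (lam ^ 2 * s * (t - s) / 2)
          + (b t * (lam ^ 2 * s / 2) + c' - lam / 2 * c t)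
            * besselClifford 2 (lam ^ 2 * s * (t - s) / 2)
          + c t * (lam ^ 2 * s / 2) * besselClifford 3 (lam ^ 2 * s * (t - s) / 2))) t :=
  ((hasDerivAt_exp_decay_fst lam t s).mul
    ((((hasDerivAt_besselClifford_comp_fst 0 lam t s).const_mul a).add
      (hb.mul (hasDerivAt_besselClifford_comp_fst 1 lam t s))).add
      (hc.mul (hasDerivAt_besselClifford_comp_fst 2 lam t s)))).congr_deriv (by
        simp only [Pi.add_apply, Pi.mul_apply]
        ring)

theorem explicit_Tz_density_satisfies_equation
    (lam : ℝ) (hlam : 0 < lam)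
    (p : ℝ → ℝ → ℝ)
    (hp : p = fun t s => (lam / 3) * Real.exp (-lam * (t + s) / 2) *
      (2 * besselI 0 (lam * Real.sqrt (2 * s * (t - s)))
        + ((2 * t - s) / Real.sqrt (2 * s * (t - s)))
            * besselI 1 (lam * Real.sqrt (2 * s * (t - s))))) :
    ∀ t s, 0 < s → s < t →
      pt2 (pt2 p) t s + pt2 (ps2 p) t s + (3 * lam / 2) * pt2 p t s
        + (lam / 2) * ps2 p t s = 0 := by
  intro t s hs hst
  have hp' : ∀ t s : ℝ, 0 < s → s < t → p t s = lam / 3 * Real.exp (-lam * (t + s) / 2) *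
      (2 * besselClifford 0 (lam ^ 2 * s * (t - s) / 2)
        + (2 * t - s) * (lam / 2) * besselClifford 1 (lam ^ 2 * s * (t - s) / 2)) := by
    intro t s hs hst
    have hpos : 0 < 2 * s * (t - s) := by have := sub_pos.mpr hst; positivity
    have hne : √(2 * s * (t - s)) ≠ 0 := (Real.sqrt_pos.mpr hpos).ne'
    have harg : (lam * √(2 * s * (t - s)) / 2) ^ 2 = lam ^ 2 * s * (t - s) / 2 := by
      rw [div_pow, mul_pow, Real.sq_sqrt hpos.le]
      ring
    simp only [hp, besselI_eq_besselClifford, harg]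
    generalize √(2 * s * (t - s)) = r at hne
    field_simp
  have hpt : ∀ t s : ℝ, 0 < s → s < t → pt2 p t s = lam / 3 * Real.exp (-lam * (t + s) / 2) *
      (-lam * besselClifford 0 (lam ^ 2 * s * (t - s) / 2)
        + (-(2 * t - s) * lam ^ 2 / 4 + lam ^ 2 * s + lam)
          * besselClifford 1 (lam ^ 2 * s * (t - s) / 2)
        + (2 * t - s) * (lam ^ 3 * s / 4)
          * besselClifford 2 (lam ^ 2 * s * (t - s) / 2)) := by
    intro t s hs hst
    have hlin : HasDerivAt (fun u : ℝ => (2 * u - s) * (lam / 2)) lam t := by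
      exact ((((hasDerivAt_id' t).const_mul 2).sub_const s).mul_const (lam / 2)).congr_deriv
        (by ring)
    have hd := (hasDerivAt_exp_decay_fst lam t s).mul
      (((hasDerivAt_besselClifford_comp_fst 0 lam t s).const_mul 2).add
        (hlin.mul (hasDerivAt_besselClifford_comp_fst 1 lam t s)))
    have hnear : ∀ᶠ u in nhds t, s < u := eventually_gt_nhds hst
    refine (hd.congr_of_eventuallyEq (hnear.mono fun u hu => hp' u s hs hu)).deriv.trans ?_
    simp only [Pi.add_apply, Pi.mul_apply]
    ring
  have hps : ∀ t s : ℝ, 0 < s → s < t → ps2 p t s = lam / 3 * Real.exp (-lam * (t + s) / 2) *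
      (-lam * besselClifford 0 (lam ^ 2 * s * (t - s) / 2)
        + (-(2 * t - s) * lam ^ 2 / 4 + lam ^ 2 * (t - 2 * s) - lam / 2)
          * besselClifford 1 (lam ^ 2 * s * (t - s) / 2)
        + (2 * t - s) * (lam ^ 3 * (t - 2 * s) / 4)
          * besselClifford 2 (lam ^ 2 * s * (t - s) / 2)) := by
    intro t s hs hst
    have hlin : HasDerivAt (fun u : ℝ => (2 * t - u) * (lam / 2)) (-lam / 2) s := by
      exact (((hasDerivAt_id' s).const_sub (2 * t)).mul_const (lam / 2)).congr_deriv (by ring)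
    have hd := (hasDerivAt_exp_decay_snd lam t s).mul
      (((hasDerivAt_besselClifford_comp_snd 0 lam t s).const_mul 2).add
        (hlin.mul (hasDerivAt_besselClifford_comp_snd 1 lam t s)))
    have hnear : ∀ᶠ u in nhds s, 0 < u ∧ u < t :=
      (eventually_gt_nhds hs).and (eventually_lt_nhds hst)
    refine (hd.congr_of_eventuallyEq (hnear.mono fun u hu => hp' t u hu.1 hu.2)).deriv.trans ?_
    simp only [Pi.add_apply, Pi.mul_apply]
    ring
  have hlin : HasDerivAt (fun u : ℝ => 2 * u - s) 2 t :=
    (((hasDerivAt_id' t).const_mul 2).sub_const s).congr_deriv (by ring)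
  have hlin' : HasDerivAt (fun u : ℝ => u - 2 * s) 1 t := (hasDerivAt_id' t).sub_const _
  have hnear : ∀ᶠ u in nhds t, s < u := eventually_gt_nhds hst
  have htt := ((hasDerivAt_damped_besselClifford_fst lam (-lam) t s _ _ _ _
    ((((hlin.fun_neg.mul_const (lam ^ 2)).div_const 4).add_const (lam ^ 2 * s)).add_const lam)
    (hlin.mul_const (lam ^ 3 * s / 4))).congr_of_eventuallyEq
      (hnear.mono fun u hu => hpt u s hs hu)).deriv
  have hts := ((hasDerivAt_damped_besselClifford_fst lam (-lam) t s _ _ _ _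
    ((((hlin.fun_neg.mul_const (lam ^ 2)).div_const 4).fun_add
      (hlin'.const_mul (lam ^ 2))).sub_const (lam / 2))
    (hlin.fun_mul ((hlin'.const_mul (lam ^ 3)).div_const 4))).congr_of_eventuallyEq
      (hnear.mono fun u hu => hps u s hs hu)).deriv
  change pt2 (pt2 p) t s = _ at htt
  change pt2 (ps2 p) t s = _ at hts
  have h0 := besselClifford_recurrence 0 (lam ^ 2 * s * (t - s) / 2)
  have h1 := besselClifford_recurrence 1 (lam ^ 2 * s * (t - s) / 2)
  norm_num at h0 h1
  rw [htt, hts, hpt t s hs hst, hps t s hs hst]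
  linear_combination lam / 3 * Real.exp (-lam * (t + s) / 2) *
    (lam ^ 2 * h0 + (2 * t - s) * lam ^ 3 / 4 * h1)
end

section
/- For an integer ν ≥ 0, let I_ν denote the modified Bessel function of the first kind, defined by the everywhere-convergent series I_ν(x) = Σ_{k=0}^∞ (x/2)^{2k+ν} / (k! (k+ν)!). Then for all real numbers A and B, ∫₀^∞ w³ e^{−w²} I₁(Aw) I₁(Bw) dw = (e^{(A²+B²)/4} / 4) [ ((A²+B²)/2) I₁(AB/2) + AB · I₀(AB/2) ]. -/
theorem summable_besselI_series (ν : ℕ) (x : ℝ) :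
    Summable fun k : ℕ =>
      (x / 2) ^ (2 * k + ν) / ((Nat.factorial k : ℝ) * (Nat.factorial (k + ν) : ℝ)) := by
  refine Summable.of_norm_bounded
    ((Real.summable_pow_div_factorial ((x / 2) ^ 2)).mul_left (|x / 2| ^ ν)) fun k => ?_
  have h1 : (1 : ℝ) ≤ (Nat.factorial (k + ν) : ℝ) := by
    exact_mod_cast Nat.one_le_iff_ne_zero.mpr (Nat.factorial_ne_zero _)
  have h2 : (0 : ℝ) < (Nat.factorial k : ℝ) := by exact_mod_cast Nat.factorial_pos k
  rw [Real.norm_eq_abs, abs_div, abs_pow, abs_of_pos (by positivity : (0 : ℝ) <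
    (Nat.factorial k : ℝ) * (Nat.factorial (k + ν) : ℝ)), pow_add, pow_mul, sq_abs,
    mul_comm, mul_div_assoc]
  gcongr
  exact le_mul_of_one_le_right h2.le h1

theorem hasSum_besselI (ν : ℕ) (x : ℝ) :
    HasSum (fun k : ℕ =>
      (x / 2) ^ (2 * k + ν) / ((Nat.factorial k : ℝ) * (Nat.factorial (k + ν) : ℝ)))
      (besselI ν x) :=
  (summable_besselI_series ν x).hasSum

theorem HasSum.mul_real {ι κ : Type*} {f : ι → ℝ} {g : κ → ℝ} {s t : ℝ}
    (hf : HasSum f s) (hg : HasSum g t) :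
    HasSum (fun x : ι × κ => f x.1 * g x.2) (s * t) :=
  hf.mul hg (summable_mul_of_summable_norm hf.summable.norm hg.summable.norm)

theorem hasSum_pow_div_factorial_exp (x : ℝ) :
    HasSum (fun n : ℕ => x ^ n / (Nat.factorial n : ℝ)) (Real.exp x) := by
  rw [Real.exp_eq_exp_ℝ]
  exact NormedSpace.expSeries_div_hasSum_exp x

theorem hasSum_nat_mul_pow_div_factorial (x : ℝ) :
    HasSum (fun n : ℕ => (n : ℝ) * (x ^ n / (Nat.factorial n : ℝ))) (x * Real.exp x) := by
  rw [← add_zero (x * Real.exp x)]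
  have h := (hasSum_nat_add_iff (f := fun n : ℕ => (n : ℝ) * (x ^ n / (Nat.factorial n : ℝ)))
    (g := x * Real.exp x) 1).mp ?_
  · simpa using h
  · refine ((hasSum_pow_div_factorial_exp x).mul_left x).congr_fun fun n => ?_
    rw [Nat.factorial_succ]
    have : (Nat.factorial n : ℝ) ≠ 0 := by exact_mod_cast Nat.factorial_ne_zero n
    push_cast
    field_simp
    ring

/-- Expansion of `exp (a² + b²) ((a² + b²) I₁(2ab) + 2ab I₀(2ab))` as a triple series. -/
theorem hasSum_exp_mul_besselI_triple (a b : ℝ) :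
    HasSum (fun x : (ℕ × ℕ) × ℕ =>
      ((x.1.1 : ℝ) + x.1.2 + 2 * (x.2 + 1)) *
        ((a ^ 2) ^ x.1.1 / (Nat.factorial x.1.1 : ℝ) *
          ((b ^ 2) ^ x.1.2 / (Nat.factorial x.1.2 : ℝ)) *
          ((a * b) ^ (2 * x.2 + 1) /
            ((Nat.factorial x.2 : ℝ) * (Nat.factorial (x.2 + 1) : ℝ)))))
      (Real.exp (a ^ 2 + b ^ 2) * ((a ^ 2 + b ^ 2) * besselI 1 (2 * (a * b)) +
        2 * (a * b) * besselI 0 (2 * (a * b)))) := by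
  have ea := hasSum_pow_div_factorial_exp (a ^ 2)
  have eb := hasSum_pow_div_factorial_exp (b ^ 2)
  have i1 := hasSum_besselI 1 (2 * (a * b))
  have i0 := (hasSum_besselI 0 (2 * (a * b))).mul_left (2 * (a * b))
  rw [mul_div_cancel_left₀ (a * b) two_ne_zero] at i0 i1
  convert ((((hasSum_nat_mul_pow_div_factorial (a ^ 2)).mul_real eb).mul_real i1).add
    ((ea.mul_real (hasSum_nat_mul_pow_div_factorial (b ^ 2))).mul_real i1)).add
    ((ea.mul_real eb).mul_real i0) using 1
  · ext ⟨⟨p, q⟩, m⟩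
    have h1 : (Nat.factorial m : ℝ) ≠ 0 := by exact_mod_cast Nat.factorial_ne_zero m
    have h2 : (m : ℝ) + 1 ≠ 0 := by positivity
    have h3 : (Nat.factorial p : ℝ) ≠ 0 := by exact_mod_cast Nat.factorial_ne_zero p
    have h4 : (Nat.factorial q : ℝ) ≠ 0 := by exact_mod_cast Nat.factorial_ne_zero q
    simp only [Nat.factorial_succ, add_zero, pow_succ]
    push_cast
    field_simp
  · rw [Real.exp_add]
    ring

theorem sum_choose_mul_choose_succ (j k : ℕ) :
    ∑ m ∈ Finset.range (k + 1), j.choose m * (k + 1).choose (m + 1) =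
      (j + (k + 1)).choose k := by
  rw [Nat.add_choose_eq,
    Finset.Nat.sum_antidiagonal_eq_sum_range_succ fun i l => j.choose i * (k + 1).choose l]
  refine Finset.sum_congr rfl fun m hm => ?_
  rw [Finset.mem_range] at hm
  rw [Nat.choose_symm_of_eq_add (a := m + 1) (b := k - m) (by omega)]

/-- Collecting equal powers of `a` and `b` in the triple series. -/
theorem hasSum_exp_mul_besselI (a b : ℝ) :
    HasSum (fun x : ℕ × ℕ =>
      a ^ (2 * x.1 + 1) * b ^ (2 * x.2 + 1) * (Nat.factorial (x.1 + x.2 + 2) : ℝ) /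
        ((Nat.factorial x.1 : ℝ) * (Nat.factorial (x.1 + 1) : ℝ) *
          ((Nat.factorial x.2 : ℝ) * (Nat.factorial (x.2 + 1) : ℝ))))
      (Real.exp (a ^ 2 + b ^ 2) * ((a ^ 2 + b ^ 2) * besselI 1 (2 * (a * b)) +
        2 * (a * b) * besselI 0 (2 * (a * b)))) := by
  let U : (ℕ × ℕ) × ℕ → ℝ := fun x =>
    ((x.1.1 : ℝ) + x.1.2 + 2) * a ^ (2 * x.1.1 + 1) * b ^ (2 * x.1.2 + 1) /
      ((Nat.factorial x.1.1 : ℝ) * (Nat.factorial (x.1.2 + 1) : ℝ)) *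
      ((x.1.1.choose x.2 * (x.1.2 + 1).choose (x.2 + 1) : ℕ) : ℝ)
  let g : (ℕ × ℕ) × ℕ → (ℕ × ℕ) × ℕ := fun x => ((x.1.1 + x.2, x.1.2 + x.2), x.2)
  have hg : Function.Injective g := by
    rintro ⟨⟨p, q⟩, m⟩ ⟨⟨p', q'⟩, m'⟩ h
    simp only [g, Prod.mk.injEq] at h ⊢
    omega
  have hU : ∀ x ∉ Set.range g, U x = 0 := by
    rintro ⟨⟨j, k⟩, m⟩ hx
    have : j < m ∨ k < m := by
      by_contra! h
      exact hx ⟨((j - m, k - m), m), by simp [g, Nat.sub_add_cancel h.1, Nat.sub_add_cancel h.2]⟩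
    rcases this with h | h
    · simp [U, Nat.choose_eq_zero_of_lt h]
    · simp [U, Nat.choose_eq_zero_of_lt (Nat.succ_lt_succ h)]
  have hUsum : HasSum U (Real.exp (a ^ 2 + b ^ 2) * ((a ^ 2 + b ^ 2) * besselI 1 (2 * (a * b)) +
        2 * (a * b) * besselI 0 (2 * (a * b)))) := by
    rw [← hg.hasSum_iff hU]
    refine (hasSum_exp_mul_besselI_triple a b).congr_fun ?_
    rintro ⟨⟨p, q⟩, m⟩
    have h1 : (Nat.factorial m : ℝ) ≠ 0 := by exact_mod_cast Nat.factorial_ne_zero m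
    have h2 : (Nat.factorial (m + 1) : ℝ) ≠ 0 := by exact_mod_cast Nat.factorial_ne_zero _
    have h3 : (Nat.factorial p : ℝ) ≠ 0 := by exact_mod_cast Nat.factorial_ne_zero p
    have h4 : (Nat.factorial q : ℝ) ≠ 0 := by exact_mod_cast Nat.factorial_ne_zero q
    have h5 : (Nat.factorial (p + m) : ℝ) ≠ 0 := by exact_mod_cast Nat.factorial_ne_zero _
    have h6 : (Nat.factorial (q + (m + 1)) : ℝ) ≠ 0 := by
      exact_mod_cast Nat.factorial_ne_zero _
    simp only [U, g, Function.comp_apply, add_assoc q m 1]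
    push_cast
    rw [Nat.cast_choose ℝ (Nat.le_add_left m p), Nat.cast_choose ℝ (Nat.le_add_left (m + 1) q),
      Nat.add_sub_cancel, Nat.add_sub_cancel]
    field_simp
    ring
  refine hUsum.prod_fiberwise ?_
  rintro ⟨j, k⟩
  have hz : ∀ m ∉ Finset.range (k + 1), U ((j, k), m) = 0 := by
    intro m hm
    rw [Finset.mem_range, not_lt] at hm
    simp [U, Nat.choose_eq_zero_of_lt (Nat.succ_lt_succ hm)]
  convert hasSum_sum_of_ne_finset_zero (L := .unconditional ℕ) hz using 1
  have h1 : (Nat.factorial j : ℝ) ≠ 0 := by exact_mod_cast Nat.factorial_ne_zero j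
  have h2 : (Nat.factorial k : ℝ) ≠ 0 := by exact_mod_cast Nat.factorial_ne_zero k
  have h3 : (j : ℝ) + 1 ≠ 0 := by positivity
  have h4 : (k : ℝ) + 1 ≠ 0 := by positivity
  simp only [U]
  rw [← Finset.mul_sum, ← Nat.cast_sum, sum_choose_mul_choose_succ,
    show j + (k + 1) = k + (j + 1) by ring, Nat.cast_add_choose,
    show j + k + 2 = (k + (j + 1)) + 1 by ring, Nat.factorial_succ (k + (j + 1)),
    Nat.factorial_succ j, Nat.factorial_succ k]
  push_cast
  field_simp
  ring

theorem integrableOn_pow_mul_exp_neg_sq (n : ℕ) :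
    MeasureTheory.IntegrableOn (fun w : ℝ => w ^ n * Real.exp (-w ^ 2)) (Set.Ioi 0) := by
  have h := integrableOn_rpow_mul_exp_neg_rpow (p := 2) (s := n)
    (by linarith [Nat.cast_nonneg (α := ℝ) n]) two_pos
  simpa only [Real.rpow_natCast, Real.rpow_ofNat] using h

theorem integral_odd_pow_mul_exp_neg_sq (n : ℕ) :
    ∫ w in Set.Ioi (0 : ℝ), w ^ (2 * n + 1) * Real.exp (-w ^ 2) =
      (Nat.factorial n : ℝ) / 2 := by
  have h := integral_rpow_mul_exp_neg_rpow (p := 2) (q := (2 * n + 1 : ℕ)) two_pos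
    (by linarith [Nat.cast_nonneg (α := ℝ) (2 * n + 1)])
  simp only [Real.rpow_natCast, Real.rpow_ofNat] at h
  rw [h, show (((2 * n + 1 : ℕ) : ℝ) + 1) / 2 = n + 1 by push_cast; ring,
    Real.Gamma_nat_eq_factorial]
  ring

theorem integral_product_besselI_one (A B : ℝ) :
    ∫ w in Set.Ioi (0 : ℝ),
        w ^ 3 * Real.exp (-w ^ 2) * besselI 1 (A * w) * besselI 1 (B * w)
    = Real.exp ((A ^ 2 + B ^ 2) / 4) / 4 *
        ((A ^ 2 + B ^ 2) / 2 * besselI 1 (A * B / 2)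
          + A * B * besselI 0 (A * B / 2)) := by
  let c : ℝ → ℝ → ℕ × ℕ → ℝ := fun a b x =>
    a ^ (2 * x.1 + 1) * b ^ (2 * x.2 + 1) /
      ((Nat.factorial x.1 : ℝ) * (Nat.factorial (x.1 + 1) : ℝ) *
        ((Nat.factorial x.2 : ℝ) * (Nat.factorial (x.2 + 1) : ℝ)))
  let F : ℕ × ℕ → ℝ → ℝ := fun x w =>
    c (A / 2) (B / 2) x * (w ^ (2 * (x.1 + x.2 + 2) + 1) * Real.exp (-w ^ 2))
  have hc : ∀ a b, HasSum (fun x => c a b x * ((Nat.factorial (x.1 + x.2 + 2) : ℝ) / 2))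
      (Real.exp (a ^ 2 + b ^ 2) * ((a ^ 2 + b ^ 2) * besselI 1 (2 * (a * b)) +
        2 * (a * b) * besselI 0 (2 * (a * b))) / 2) := fun a b =>
    ((hasSum_exp_mul_besselI a b).div_const 2).congr_fun fun x => by simp only [c]; ring
  have hint : ∀ x, ∫ w in Set.Ioi (0 : ℝ), F x w =
      c (A / 2) (B / 2) x * ((Nat.factorial (x.1 + x.2 + 2) : ℝ) / 2) := fun x => by
    rw [MeasureTheory.integral_const_mul, integral_odd_pow_mul_exp_neg_sq]
  have hnorm : ∀ x, ∫ w in Set.Ioi (0 : ℝ), ‖F x w‖ =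
      c |A / 2| |B / 2| x * ((Nat.factorial (x.1 + x.2 + 2) : ℝ) / 2) := fun x => by
    rw [← integral_odd_pow_mul_exp_neg_sq, ← MeasureTheory.integral_const_mul]
    refine MeasureTheory.setIntegral_congr_fun measurableSet_Ioi fun w hw => ?_
    have hw' : (0 : ℝ) < w := hw
    simp only [F, c, norm_mul, norm_div, norm_pow, Real.norm_eq_abs, Nat.abs_cast,
      Real.abs_exp, abs_of_pos hw', abs_div]
  have hF : HasSum (fun x => ∫ w in Set.Ioi (0 : ℝ), F x w)
      (∫ w in Set.Ioi (0 : ℝ), ∑' x, F x w) := by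
    refine MeasureTheory.hasSum_integral_of_summable_integral_norm
      (fun x => (integrableOn_pow_mul_exp_neg_sq _).const_mul _) ?_
    simp only [hnorm]
    exact (hc _ _).summable
  have hprod : ∀ w : ℝ, w ^ 3 * Real.exp (-w ^ 2) * besselI 1 (A * w) * besselI 1 (B * w) =
      ∑' x, F x w := fun w => by
    rw [mul_assoc]
    refine ((((hasSum_besselI 1 (A * w)).mul_real (hasSum_besselI 1 (B * w))).mul_left
      (w ^ 3 * Real.exp (-w ^ 2))).congr_fun fun x => ?_).tsum_eq.symm
    simp only [F, c]
    rw [mul_div_right_comm A, mul_div_right_comm B, mul_pow, mul_pow]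
    ring
  simp only [hint] at hF
  simp only [hprod]
  rw [hF.unique (hc _ _), show (A / 2) ^ 2 + (B / 2) ^ 2 = (A ^ 2 + B ^ 2) / 4 by ring,
    show 2 * (A / 2 * (B / 2)) = A * B / 2 by ring]
  ring
end

section
/- For an integer ν ≥ 0, let I_ν denote the modified Bessel function of the first kind, defined by the everywhere-convergent series I_ν(x) = Σ_{k=0}^∞ (x/2)^{2k+ν} / (k! (k+ν)!). Let λ, c, t > 0 and let x be a real number with |x| < ct. Then (1/2) Σ_{m=0}^∞ Σ_{n=0}^∞ (2λ/c)^{m+n+1} · (ct−x)^m (ct+x)^n / 2^{2(m+n+1)} · (m+n+2)! / (m!(m+1)! n!(n+1)!) = (1/√(c²t²−x²)) ∫₀^∞ e^{−w²} w³ I₁(w√(2λ(ct−x)/c)) I₁(w√(2λ(ct+x)/c)) dw. -/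
theorem integral_Ioi_exp_neg_sq_mul_pow_odd (k : ℕ) :
    ∫ w in Set.Ioi (0 : ℝ), Real.exp (-w ^ 2) * w ^ (2 * k + 1) = (Nat.factorial k : ℝ) / 2 := by
  have h := integral_rpow_mul_exp_neg_rpow (p := 2) (q := ((2 * k + 1 : ℕ) : ℝ)) (by norm_num)
    (by have : (0 : ℝ) ≤ ((2 * k + 1 : ℕ) : ℝ) := Nat.cast_nonneg _
        linarith)
  have hk : (((2 * k + 1 : ℕ) : ℝ) + 1) / 2 = (k : ℝ) + 1 := by push_cast; ring
  rw [hk, Real.Gamma_nat_eq_factorial] at h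
  simp only [Real.rpow_natCast, Real.rpow_two] at h
  simp only [mul_comm (Real.exp _), h]
  ring

theorem integrableOn_Ioi_exp_neg_sq_mul_pow_odd (k : ℕ) :
    MeasureTheory.IntegrableOn (fun w : ℝ ↦ Real.exp (-w ^ 2) * w ^ (2 * k + 1)) (Set.Ioi 0) := by
  refine MeasureTheory.Integrable.of_integral_ne_zero ?_
  rw [integral_Ioi_exp_neg_sq_mul_pow_odd]
  positivity

/-- The `k`-th term of the power series of `besselI 1`. -/
noncomputable def besselOneTerm (k : ℕ) (x : ℝ) : ℝ :=
  (x / 2) ^ (2 * k + 1) / ((Nat.factorial k : ℝ) * (Nat.factorial (k + 1) : ℝ))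

theorem besselOneTerm_nonneg (k : ℕ) {x : ℝ} (hx : 0 ≤ x) : 0 ≤ besselOneTerm k x := by
  unfold besselOneTerm
  positivity

theorem besselOneTerm_mul (k : ℕ) (w x : ℝ) :
    besselOneTerm k (w * x) = w ^ (2 * k + 1) * besselOneTerm k x := by
  unfold besselOneTerm
  rw [mul_div_assoc w x 2, mul_pow, mul_div_assoc]

theorem summable_norm_besselOneTerm (x : ℝ) : Summable fun k ↦ ‖besselOneTerm k x‖ := by
  refine Summable.of_nonneg_of_le (fun _ ↦ norm_nonneg _) (fun k ↦ ?_)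
    ((Real.summable_pow_div_factorial ((x / 2) ^ 2)).mul_left |x / 2|)
  have h1 : (1 : ℝ) ≤ (Nat.factorial (k + 1) : ℝ) := by
    exact_mod_cast Nat.succ_le_of_lt (Nat.factorial_pos _)
  have h0 : (0 : ℝ) < Nat.factorial k := by positivity
  have habs : ‖besselOneTerm k x‖ = |x / 2| * ((x / 2) ^ 2) ^ k /
      ((Nat.factorial k : ℝ) * (Nat.factorial (k + 1) : ℝ)) := by
    rw [besselOneTerm, norm_div, norm_pow, Real.norm_eq_abs, Real.norm_eq_abs,
      abs_of_pos (a := (_ : ℝ) * _) (by positivity), pow_succ, pow_mul, sq_abs, mul_comm]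
  rw [habs, ← mul_div_assoc]
  gcongr
  exact le_mul_of_one_le_right h0.le h1

theorem besselI_one_mul_besselI_one (x y : ℝ) :
    besselI 1 x * besselI 1 y = ∑' p : ℕ × ℕ, besselOneTerm p.1 x * besselOneTerm p.2 y :=
  tsum_mul_tsum_of_summable_norm (summable_norm_besselOneTerm x) (summable_norm_besselOneTerm y)

theorem factorial_add_two_le (m n : ℕ) :
    Nat.factorial (m + n + 2) ≤
      2 ^ (m + n + 2) * (Nat.factorial (m + 1) * Nat.factorial (n + 1)) := by
  have h := Nat.add_choose_mul_factorial_mul_factorial (m + 1) (n + 1)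
  rw [show m + 1 + (n + 1) = m + n + 2 by ring, mul_assoc] at h
  rw [← h]
  exact Nat.mul_le_mul_right _ (Nat.choose_le_two_pow _ _)

theorem summable_besselOneTerm_mul_factorial {a b : ℝ} (ha : 0 ≤ a) (hb : 0 ≤ b) :
    Summable fun p : ℕ × ℕ ↦ besselOneTerm p.1 a * besselOneTerm p.2 b *
      ((Nat.factorial (p.1 + p.2 + 2) : ℝ) / 2) := by
  have hs := ((Real.summable_pow_div_factorial (2 * (a / 2) ^ 2)).mul_of_nonneg
    (Real.summable_pow_div_factorial (2 * (b / 2) ^ 2))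
    (fun k ↦ by positivity) (fun k ↦ by positivity)).mul_left (2 * (a / 2) * (b / 2))
  refine Summable.of_nonneg_of_le (fun p ↦ ?_) (fun p ↦ ?_) hs
  · have := besselOneTerm_nonneg p.1 ha
    have := besselOneTerm_nonneg p.2 hb
    positivity
  · obtain ⟨m, n⟩ := p
    have h : (Nat.factorial (m + n + 2) : ℝ) ≤
        2 ^ (m + n + 2) * (Nat.factorial (m + 1) * Nat.factorial (n + 1)) := by
      exact_mod_cast factorial_add_two_le m n
    have ha' := besselOneTerm_nonneg m ha
    have hb' := besselOneTerm_nonneg n hb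
    calc besselOneTerm m a * besselOneTerm n b * ((Nat.factorial (m + n + 2) : ℝ) / 2)
        ≤ besselOneTerm m a * besselOneTerm n b *
          (2 ^ (m + n + 2) * (Nat.factorial (m + 1) * Nat.factorial (n + 1)) / 2) := by gcongr
      _ = _ := by
        unfold besselOneTerm
        have := Nat.cast_ne_zero (R := ℝ).2 (Nat.factorial_ne_zero m)
        have := Nat.cast_ne_zero (R := ℝ).2 (Nat.factorial_ne_zero n)
        have := Nat.cast_ne_zero (R := ℝ).2 (Nat.factorial_ne_zero (m + 1))
        have := Nat.cast_ne_zero (R := ℝ).2 (Nat.factorial_ne_zero (n + 1))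
        generalize a / 2 = u, b / 2 = v
        simp only [mul_pow, ← pow_mul]
        field_simp
        ring

theorem integral_exp_neg_sq_mul_besselI_one_mul_besselI_one {a b : ℝ} (ha : 0 ≤ a) (hb : 0 ≤ b) :
    ∫ w in Set.Ioi (0 : ℝ),
        Real.exp (-w ^ 2) * w ^ 3 * besselI 1 (w * a) * besselI 1 (w * b) =
      ∑' m : ℕ, ∑' n : ℕ, besselOneTerm m a * besselOneTerm n b *
        ((Nat.factorial (m + n + 2) : ℝ) / 2) := by
  let F : ℕ × ℕ → ℝ → ℝ := fun p w ↦ besselOneTerm p.1 a * besselOneTerm p.2 b *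
    (Real.exp (-w ^ 2) * w ^ (2 * (p.1 + p.2 + 2) + 1))
  have hF_int (p : ℕ × ℕ) : MeasureTheory.IntegrableOn (F p) (Set.Ioi 0) :=
    (integrableOn_Ioi_exp_neg_sq_mul_pow_odd _).const_mul _
  have hF_val (p : ℕ × ℕ) : ∫ w in Set.Ioi (0 : ℝ), F p w =
      besselOneTerm p.1 a * besselOneTerm p.2 b * ((Nat.factorial (p.1 + p.2 + 2) : ℝ) / 2) := by
    rw [MeasureTheory.integral_const_mul, integral_Ioi_exp_neg_sq_mul_pow_odd]
  have hF_norm (p : ℕ × ℕ) : ∫ w in Set.Ioi (0 : ℝ), ‖F p w‖ = ∫ w in Set.Ioi (0 : ℝ), F p w := by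
    refine MeasureTheory.setIntegral_congr_fun measurableSet_Ioi fun w hw ↦ ?_
    have hw : 0 < w := hw
    have := besselOneTerm_nonneg p.1 ha
    have := besselOneTerm_nonneg p.2 hb
    exact Real.norm_of_nonneg (by positivity)
  have hsum := summable_besselOneTerm_mul_factorial ha hb
  have key := MeasureTheory.integral_tsum_of_summable_integral_norm hF_int
    (by simpa only [hF_norm, hF_val] using hsum)
  simp only [hF_val] at key
  rw [← hsum.tsum_prod, key]
  congr 1 with w
  rw [mul_assoc, besselI_one_mul_besselI_one, ← tsum_mul_left]
  congr 1 with p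
  simp only [F, besselOneTerm_mul]
  ring

theorem telegraph_series_integral_representation
    (lam c t x : ℝ) (hlam : 0 < lam) (hc : 0 < c) (ht : 0 < t)
    (hx : |x| < c * t) :
    (1 / 2) * ∑' m : ℕ, ∑' n : ℕ,
        (2 * lam / c) ^ (m + n + 1) *
          ((c * t - x) ^ m * (c * t + x) ^ n / 2 ^ (2 * (m + n + 1))) *
          ((Nat.factorial (m + n + 2) : ℝ) /
            ((Nat.factorial m : ℝ) * (Nat.factorial (m + 1) : ℝ) *
              (Nat.factorial n : ℝ) * (Nat.factorial (n + 1) : ℝ)))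
    = (1 / Real.sqrt (c ^ 2 * t ^ 2 - x ^ 2)) *
        ∫ w in Set.Ioi (0 : ℝ),
          Real.exp (-w ^ 2) * w ^ 3 *
            besselI 1 (w * Real.sqrt (2 * lam * (c * t - x) / c)) *
            besselI 1 (w * Real.sqrt (2 * lam * (c * t + x) / c)) := by
  obtain ⟨hx1, hx2⟩ := abs_lt.1 hx
  have hu : 0 < c * t - x := by linarith
  have hv : 0 < c * t + x := by linarith
  have hr : 0 < 2 * lam / c := by positivity
  rw [integral_exp_neg_sq_mul_besselI_one_mul_besselI_one (Real.sqrt_nonneg _) (Real.sqrt_nonneg _),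
    ← tsum_mul_left, ← tsum_mul_left]
  congr 1 with m
  rw [← tsum_mul_left, ← tsum_mul_left]
  congr 1 with n
  rw [show c ^ 2 * t ^ 2 - x ^ 2 = (c * t - x) * (c * t + x) by ring,
    mul_div_right_comm (2 * lam), mul_div_right_comm (2 * lam)]
  generalize c * t - x = u at *
  generalize c * t + x = v at *
  generalize 2 * lam / c = r at *
  rw [Real.sqrt_mul hu.le, Real.sqrt_mul hr.le, Real.sqrt_mul hr.le]
  obtain ⟨p, hp, rfl⟩ : ∃ p, 0 < p ∧ p ^ 2 = u := ⟨√u, Real.sqrt_pos.2 hu, Real.sq_sqrt hu.le⟩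
  obtain ⟨q, hq, rfl⟩ : ∃ q, 0 < q ∧ q ^ 2 = v := ⟨√v, Real.sqrt_pos.2 hv, Real.sq_sqrt hv.le⟩
  obtain ⟨s, hs, rfl⟩ : ∃ s, 0 < s ∧ s ^ 2 = r := ⟨√r, Real.sqrt_pos.2 hr, Real.sq_sqrt hr.le⟩
  simp only [Real.sqrt_sq hp.le, Real.sqrt_sq hq.le, Real.sqrt_sq hs.le, besselOneTerm, div_pow,
    mul_pow, ← pow_mul]
  have := Nat.cast_ne_zero (R := ℝ).2 (Nat.factorial_ne_zero m)
  have := Nat.cast_ne_zero (R := ℝ).2 (Nat.factorial_ne_zero n)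
  have := Nat.cast_ne_zero (R := ℝ).2 (Nat.factorial_ne_zero (m + 1))
  have := Nat.cast_ne_zero (R := ℝ).2 (Nat.factorial_ne_zero (n + 1))
  field_simp
  ring
end

section
/- For an integer ν ≥ 0, let I_ν denote the modified Bessel function of the first kind, defined by the everywhere-convergent series I_ν(x) = Σ_{k=0}^∞ (x/2)^{2k+ν} / (k! (k+ν)!). Let λ, c > 0 and let z₀, z₁, z₂ > 0. Then Σ_{n₀=0}^∞ Σ_{n₁=0}^∞ Σ_{n₂=0}^∞ (λ/c)^{n₀+n₁+n₂+2} · (n₀+n₁+n₂+3)! / 3^{2(n₀+n₁+n₂)+4} · z₀^{n₀} z₁^{n₁} z₂^{n₂} / (n₀!(n₀+1)! n₁!(n₁+1)! n₂!(n₂+1)!) = (2/3) √(λ/c) (z₀z₁z₂)^{−1/2} ∫₀^∞ e^{−u²} u⁴ I₁((2u/3)√(λz₀/c)) I₁((2u/3)√(λz₁/c)) I₁((2u/3)√(λz₂/c)) du. -/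
open MeasureTheory Set

/-- The power-series coefficient of the product of three first-order Bessel functions
`besselI 1 (2 * a i * u)` as functions of `u`. -/
noncomputable def besselTripleCoeff (a b c : ℝ) (n : ℕ × ℕ × ℕ) : ℝ :=
  a ^ (2 * n.1 + 1) / ((n.1.factorial : ℝ) * ((n.1 + 1).factorial : ℝ)) *
    (b ^ (2 * n.2.1 + 1) / ((n.2.1.factorial : ℝ) * ((n.2.1 + 1).factorial : ℝ)) *
      (c ^ (2 * n.2.2 + 1) / ((n.2.2.factorial : ℝ) * ((n.2.2 + 1).factorial : ℝ))))

lemma besselTripleCoeff_nonneg {a b c : ℝ} (ha : 0 ≤ a) (hb : 0 ≤ b) (hc : 0 ≤ c)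
    (n : ℕ × ℕ × ℕ) : 0 ≤ besselTripleCoeff a b c n := by
  unfold besselTripleCoeff
  positivity

lemma summable_pow_div_factorial_mul_factorial_succ {x : ℝ} (hx : 0 ≤ x) :
    Summable fun k : ℕ => x ^ (2 * k + 1) / ((k.factorial : ℝ) * ((k + 1).factorial : ℝ)) := by
  refine Summable.of_nonneg_of_le (fun k => by positivity) (fun k => ?_)
    ((Real.summable_pow_div_factorial (x ^ 2)).mul_left x)
  have h : (1 : ℝ) ≤ ((k + 1).factorial : ℝ) := by
    exact_mod_cast Nat.succ_le_of_lt (Nat.factorial_pos _)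
  rw [pow_succ, pow_mul, mul_comm _ x, mul_div_assoc]
  gcongr
  exact le_mul_of_one_le_right (by positivity) h

lemma besselI_one_two_mul (x : ℝ) :
    besselI 1 (2 * x) =
      ∑' k : ℕ, x ^ (2 * k + 1) / ((k.factorial : ℝ) * ((k + 1).factorial : ℝ)) := by
  simp [besselI]

lemma hasSum_besselI_one_mul_mul {a b c u : ℝ} (ha : 0 ≤ a) (hb : 0 ≤ b) (hc : 0 ≤ c)
    (hu : 0 ≤ u) :
    HasSum (fun n : ℕ × ℕ × ℕ => besselTripleCoeff a b c n * u ^ (2 * (n.1 + n.2.1 + n.2.2) + 3))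
      (besselI 1 (2 * (a * u)) * (besselI 1 (2 * (b * u)) * besselI 1 (2 * (c * u)))) := by
  have hA := summable_pow_div_factorial_mul_factorial_succ (mul_nonneg ha hu)
  have hB := summable_pow_div_factorial_mul_factorial_succ (mul_nonneg hb hu)
  have hC := summable_pow_div_factorial_mul_factorial_succ (mul_nonneg hc hu)
  have hBC := hB.mul_of_nonneg hC (fun k => by positivity) (fun k => by positivity)
  have hABC := hA.mul_of_nonneg hBC (fun k => by positivity)
    (fun k => by simp only [Pi.zero_apply]; positivity)
  simp only [besselI_one_two_mul]
  refine (hA.hasSum.mul (hB.hasSum.mul hC.hasSum hBC) hABC).congr_fun fun n => ?_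
  simp only [besselTripleCoeff, mul_pow]
  ring

lemma factorial_add_le_two_pow (m n : ℕ) :
    (m + n).factorial ≤ 2 ^ (m + n) * (m.factorial * n.factorial) := by
  rw [← Nat.add_choose_mul_factorial_mul_factorial m n, mul_assoc]
  gcongr
  exact Nat.choose_le_two_pow _ _

lemma factorial_add_add_le_four_pow (l m n : ℕ) :
    (l + (m + n)).factorial ≤
      4 ^ (l + (m + n)) * (l.factorial * (m.factorial * n.factorial)) := by
  calc (l + (m + n)).factorial
      ≤ 2 ^ (l + (m + n)) * (l.factorial * (m + n).factorial) := factorial_add_le_two_pow _ _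
    _ ≤ 2 ^ (l + (m + n)) *
          (l.factorial * (2 ^ (l + (m + n)) * (m.factorial * n.factorial))) := by
        gcongr
        refine (factorial_add_le_two_pow m n).trans ?_
        exact Nat.mul_le_mul_right _ (Nat.pow_le_pow_right (by norm_num) (Nat.le_add_left _ _))
    _ = 4 ^ (l + (m + n)) * (l.factorial * (m.factorial * n.factorial)) := by
        rw [show (4 : ℕ) = 2 * 2 by norm_num, mul_pow]
        ring

lemma summable_besselTripleCoeff_mul_factorial {a b c : ℝ} (ha : 0 ≤ a) (hb : 0 ≤ b)
    (hc : 0 ≤ c) :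
    Summable fun n : ℕ × ℕ × ℕ =>
      besselTripleCoeff a b c n * ((n.1 + n.2.1 + n.2.2 + 3).factorial : ℝ) := by
  have key (x : ℝ) : Summable fun k : ℕ => 4 * x * ((4 * x ^ 2) ^ k / (k.factorial : ℝ)) :=
    (Real.summable_pow_div_factorial _).mul_left _
  have hBC := (key b).mul_of_nonneg (key c) (fun k => by simp only [Pi.zero_apply]; positivity)
    (fun k => by simp only [Pi.zero_apply]; positivity)
  refine Summable.of_nonneg_of_le
    (fun n => mul_nonneg (besselTripleCoeff_nonneg ha hb hc n) (by positivity)) ?_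
    ((key a).mul_of_nonneg hBC (fun k => by simp only [Pi.zero_apply]; positivity)
      (fun k => by simp only [Pi.zero_apply]; positivity))
  rintro ⟨i, j, k⟩
  have hfac : ((i + j + k + 3).factorial : ℝ) ≤ 4 ^ (i + 1 + (j + 1 + (k + 1))) *
      (((i + 1).factorial : ℝ) * (((j + 1).factorial : ℝ) * ((k + 1).factorial : ℝ))) := by
    rw [show i + j + k + 3 = i + 1 + (j + 1 + (k + 1)) by ring]
    exact_mod_cast factorial_add_add_le_four_pow (i + 1) (j + 1) (k + 1)
  refine (mul_le_mul_of_nonneg_left hfac (besselTripleCoeff_nonneg ha hb hc _)).trans_eq ?_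
  have hi : ((i + 1).factorial : ℝ) ≠ 0 := by positivity
  have hj : ((j + 1).factorial : ℝ) ≠ 0 := by positivity
  have hk : ((k + 1).factorial : ℝ) ≠ 0 := by positivity
  simp only [besselTripleCoeff]
  field_simp
  ring

lemma integrableOn_exp_neg_sq_mul_pow (m : ℕ) :
    IntegrableOn (fun u : ℝ => Real.exp (-u ^ 2) * u ^ m) (Ioi 0) := by
  have h := integrableOn_rpow_mul_exp_neg_rpow (s := (m : ℝ)) (p := 2)
    (by have : (0 : ℝ) ≤ m := m.cast_nonneg
        linarith) (by norm_num)
  refine h.congr_fun (fun u _ => ?_) measurableSet_Ioi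
  simp only [Real.rpow_natCast, Real.rpow_two]
  ring

lemma integral_exp_neg_sq_mul_pow_odd (n : ℕ) :
    ∫ u in Ioi (0 : ℝ), Real.exp (-u ^ 2) * u ^ (2 * n + 1) = (n.factorial : ℝ) / 2 := by
  have h := integral_rpow_mul_exp_neg_rpow (p := 2) (q := ((2 * n + 1 : ℕ) : ℝ)) (by norm_num)
    (by have : (0 : ℝ) ≤ ((2 * n + 1 : ℕ) : ℝ) := Nat.cast_nonneg _
        linarith)
  have hq : (((2 * n + 1 : ℕ) : ℝ) + 1) / 2 = n + 1 := by
    push_cast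
    ring
  rw [hq, Real.Gamma_nat_eq_factorial] at h
  rw [div_eq_inv_mul, ← one_div, ← h]
  refine setIntegral_congr_fun measurableSet_Ioi (fun u _ => ?_)
  simp only [Real.rpow_natCast, Real.rpow_two]
  ring

lemma hasSum_integral_exp_neg_sq_mul_besselI_one {a b c : ℝ} (ha : 0 ≤ a) (hb : 0 ≤ b)
    (hc : 0 ≤ c) :
    HasSum (fun n : ℕ × ℕ × ℕ =>
        besselTripleCoeff a b c n * (((n.1 + n.2.1 + n.2.2 + 3).factorial : ℝ) / 2))
      (∫ u in Ioi (0 : ℝ), Real.exp (-u ^ 2) * u ^ 4 *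
        (besselI 1 (2 * (a * u)) * (besselI 1 (2 * (b * u)) * besselI 1 (2 * (c * u))))) := by
  let F (n : ℕ × ℕ × ℕ) (u : ℝ) : ℝ :=
    besselTripleCoeff a b c n * (Real.exp (-u ^ 2) * u ^ (2 * (n.1 + n.2.1 + n.2.2 + 3) + 1))
  have hF_int (n) : ∫ u in Ioi (0 : ℝ), F n u =
      besselTripleCoeff a b c n * (((n.1 + n.2.1 + n.2.2 + 3).factorial : ℝ) / 2) := by
    simp only [F]
    rw [integral_const_mul, integral_exp_neg_sq_mul_pow_odd]
  have hF_norm (n) : ∫ u in Ioi (0 : ℝ), ‖F n u‖ =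
      besselTripleCoeff a b c n * (((n.1 + n.2.1 + n.2.2 + 3).factorial : ℝ) / 2) := by
    rw [← hF_int]
    refine setIntegral_congr_fun measurableSet_Ioi (fun u hu => Real.norm_of_nonneg ?_)
    have : 0 < u := hu
    exact mul_nonneg (besselTripleCoeff_nonneg ha hb hc n) (by positivity)
  have hsum := hasSum_integral_of_summable_integral_norm (μ := volume.restrict (Ioi (0 : ℝ)))
    (F := F) (fun n => (integrableOn_exp_neg_sq_mul_pow _).const_mul _) (by
      simp only [hF_norm, ← mul_div_assoc]
      exact (summable_besselTripleCoeff_mul_factorial ha hb hc).div_const 2)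
  simp only [hF_int] at hsum
  suffices h : ∫ u in Ioi (0 : ℝ), Real.exp (-u ^ 2) * u ^ 4 *
      (besselI 1 (2 * (a * u)) * (besselI 1 (2 * (b * u)) * besselI 1 (2 * (c * u)))) =
      ∫ u in Ioi (0 : ℝ), ∑' n, F n u by rwa [h]
  refine setIntegral_congr_fun measurableSet_Ioi (fun u hu => ?_)
  have h := (hasSum_besselI_one_mul_mul ha hb hc (le_of_lt hu)).mul_left
    (Real.exp (-u ^ 2) * u ^ 4)
  refine h.tsum_eq.symm.trans (tsum_congr fun n => ?_)
  simp only [F]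
  ring

lemma HasSum.tsum_tsum_tsum_eq {f : ℕ × ℕ × ℕ → ℝ} {s : ℝ} (h : HasSum f s) :
    ∑' (i : ℕ) (j : ℕ) (k : ℕ), f (i, j, k) = s := by
  rw [← h.tsum_eq, h.summable.tsum_prod]
  exact tsum_congr fun i => ((h.summable.prod_factor i).tsum_prod).symm

theorem planar_three_directions_integral_representation
    (lam c z0 z1 z2 : ℝ) (hlam : 0 < lam) (hc : 0 < c)
    (hz0 : 0 < z0) (hz1 : 0 < z1) (hz2 : 0 < z2) :
    ∑' n0 : ℕ, ∑' n1 : ℕ, ∑' n2 : ℕ,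
        (lam / c) ^ (n0 + n1 + n2 + 2) *
          ((Nat.factorial (n0 + n1 + n2 + 3) : ℝ) / 3 ^ (2 * (n0 + n1 + n2) + 4)) *
          (z0 ^ n0 * z1 ^ n1 * z2 ^ n2 /
            ((Nat.factorial n0 : ℝ) * (Nat.factorial (n0 + 1) : ℝ) *
              (Nat.factorial n1 : ℝ) * (Nat.factorial (n1 + 1) : ℝ) *
              (Nat.factorial n2 : ℝ) * (Nat.factorial (n2 + 1) : ℝ)))
    = (2 / 3) * Real.sqrt (lam / c) * (1 / Real.sqrt (z0 * z1 * z2)) *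
        ∫ u in Set.Ioi (0 : ℝ),
          Real.exp (-u ^ 2) * u ^ 4 *
            besselI 1 ((2 * u / 3) * Real.sqrt (lam * z0 / c)) *
            besselI 1 ((2 * u / 3) * Real.sqrt (lam * z1 / c)) *
            besselI 1 ((2 * u / 3) * Real.sqrt (lam * z2 / c)) := by
  set p := Real.sqrt (lam / c) with hp
  have hr : 0 < lam / c := by positivity
  have hp0 : 0 < p := Real.sqrt_pos.2 hr
  have hp2 : lam / c = p ^ 2 := (Real.sq_sqrt hr.le).symm
  have hsplit (z : ℝ) : Real.sqrt (lam * z / c) = p * Real.sqrt z := by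
    rw [hp, ← Real.sqrt_mul hr.le]
    congr 1
    ring
  obtain ⟨y0, hy0, rfl⟩ : ∃ y : ℝ, 0 < y ∧ z0 = y ^ 2 :=
    ⟨_, Real.sqrt_pos.2 hz0, (Real.sq_sqrt hz0.le).symm⟩
  obtain ⟨y1, hy1, rfl⟩ : ∃ y : ℝ, 0 < y ∧ z1 = y ^ 2 :=
    ⟨_, Real.sqrt_pos.2 hz1, (Real.sq_sqrt hz1.le).symm⟩
  obtain ⟨y2, hy2, rfl⟩ : ∃ y : ℝ, 0 < y ∧ z2 = y ^ 2 :=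
    ⟨_, Real.sqrt_pos.2 hz2, (Real.sq_sqrt hz2.le).symm⟩
  have hprod : Real.sqrt (y0 ^ 2 * y1 ^ 2 * y2 ^ 2) = y0 * y1 * y2 := by
    rw [← mul_pow, ← mul_pow, Real.sqrt_sq (by positivity)]
  have hsum := (hasSum_integral_exp_neg_sq_mul_besselI_one
    (a := p * y0 / 3) (b := p * y1 / 3) (c := p * y2 / 3)
    (by positivity) (by positivity) (by positivity)).mul_left
      (2 / 3 * p * (1 / (y0 * y1 * y2)))
  rw [hprod]
  simp only [hsplit, Real.sqrt_sq hy0.le, Real.sqrt_sq hy1.le, Real.sqrt_sq hy2.le, hp2]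
  convert hsum.tsum_tsum_tsum_eq using 1
  · refine tsum_congr fun i => tsum_congr fun j => tsum_congr fun k => ?_
    simp only [besselTripleCoeff, div_pow]
    field_simp
    ring
  · congr 1
    refine integral_congr_ae (Filter.Eventually.of_forall fun u => ?_)
    have harg (y : ℝ) : 2 * u / 3 * (p * y) = 2 * (p * y / 3 * u) := by ring
    simp only [harg]
    ring
end

section
/- For every real number Λ ≥ 0, 8 Σ_{n=2}^∞ (e^{−Λ} Λⁿ / n!) · Σ_{(k₁,k₂,k₃)} ((n+1)! / (k₁! k₂! k₃!)) (1/6)^{n+1} = 4 (e^{−Λ/2} − 2 e^{−2Λ/3} + e^{−5Λ/6}), where the inner sum runs over all triples of integers k₁, k₂, k₃ ≥ 1 with k₁+k₂+k₃ = n+1. -/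
/-- A binomial sum with weights `1 / (i! j!)` over an antidiagonal. -/
lemma sum_antidiagonal_pow_mul_pow_div_factorial (x y : ℝ) (n : ℕ) :
    ∑ p ∈ Finset.HasAntidiagonal.antidiagonal n,
        x ^ p.1 * y ^ p.2 / ((Nat.factorial p.1 : ℝ) * (Nat.factorial p.2 : ℝ))
      = (x + y) ^ n / (Nat.factorial n : ℝ) := by
  rw [(Commute.all x y).add_pow', Finset.sum_div]
  refine Finset.sum_congr rfl fun p hp => ?_
  rw [Finset.HasAntidiagonal.mem_antidiagonal] at hp
  subst hp
  have h := Nat.add_choose_mul_factorial_mul_factorial p.1 p.2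
  rw [← Nat.choose_symm_add] at h
  have h' : ((p.1 + p.2).choose p.1 : ℝ) * (Nat.factorial p.1 : ℝ) * (Nat.factorial p.2 : ℝ)
      = (Nat.factorial (p.1 + p.2) : ℝ) := by exact_mod_cast h
  have h₁ : (Nat.factorial p.1 : ℝ) ≠ 0 := by positivity
  have h₂ : (Nat.factorial p.2 : ℝ) ≠ 0 := by positivity
  have h₃ : (Nat.factorial (p.1 + p.2) : ℝ) ≠ 0 := by positivity
  rw [nsmul_eq_mul, div_eq_div_iff (by positivity) h₃, ← h']
  ring

/-- The reciprocal multinomial weights of the compositions of `n` into two positive parts. -/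
lemma sum_antidiagonal_pos_div_factorial (n : ℕ) :
    ∑ p ∈ Finset.HasAntidiagonal.antidiagonal n, (1 - (0 : ℝ) ^ p.1) * (1 - (0 : ℝ) ^ p.2)
        / ((Nat.factorial p.1 : ℝ) * (Nat.factorial p.2 : ℝ))
      = (2 ^ n - 2 + 0 ^ n) / (Nat.factorial n : ℝ) := by
  have h₁ := sum_antidiagonal_pow_mul_pow_div_factorial 1 1 n
  have h₂ := sum_antidiagonal_pow_mul_pow_div_factorial 1 0 n
  have h₃ := sum_antidiagonal_pow_mul_pow_div_factorial 0 1 n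
  have h₄ := sum_antidiagonal_pow_mul_pow_div_factorial 0 0 n
  have h : (2 ^ n - 2 + 0 ^ n) / (Nat.factorial n : ℝ)
      = (1 + 1) ^ n / (Nat.factorial n : ℝ) - (1 + 0) ^ n / (Nat.factorial n : ℝ)
        - (0 + 1) ^ n / (Nat.factorial n : ℝ) + (0 + 0) ^ n / (Nat.factorial n : ℝ) := by
    norm_num
    ring
  rw [h, ← h₁, ← h₂, ← h₃, ← h₄, ← Finset.sum_sub_distrib, ← Finset.sum_sub_distrib,
    ← Finset.sum_add_distrib]
  refine Finset.sum_congr rfl fun p _ => ?_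
  simp only [one_pow]
  ring

/-- The reciprocal multinomial weights of the compositions of `n` into three positive parts. -/
lemma sum_antidiagonal_antidiagonal_pos_div_factorial (n : ℕ) :
    ∑ p ∈ Finset.HasAntidiagonal.antidiagonal n, ∑ q ∈ Finset.HasAntidiagonal.antidiagonal p.2,
        (1 - (0 : ℝ) ^ p.1) / (Nat.factorial p.1 : ℝ)
          * ((1 - (0 : ℝ) ^ q.1) * (1 - (0 : ℝ) ^ q.2)
            / ((Nat.factorial q.1 : ℝ) * (Nat.factorial q.2 : ℝ)))
      = (3 ^ n - 3 * 2 ^ n + 3 - 0 ^ n) / (Nat.factorial n : ℝ) := by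
  simp only [← Finset.mul_sum, sum_antidiagonal_pos_div_factorial]
  have h₁ := sum_antidiagonal_pow_mul_pow_div_factorial 1 2 n
  have h₂ := sum_antidiagonal_pow_mul_pow_div_factorial 1 1 n
  have h₃ := sum_antidiagonal_pow_mul_pow_div_factorial 1 0 n
  have h₄ := sum_antidiagonal_pow_mul_pow_div_factorial 0 2 n
  have h₅ := sum_antidiagonal_pow_mul_pow_div_factorial 0 1 n
  have h₆ := sum_antidiagonal_pow_mul_pow_div_factorial 0 0 n
  have h : (3 ^ n - 3 * 2 ^ n + 3 - 0 ^ n) / (Nat.factorial n : ℝ)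
      = (1 + 2) ^ n / (Nat.factorial n : ℝ) - 2 * ((1 + 1) ^ n / (Nat.factorial n : ℝ))
        + (1 + 0) ^ n / (Nat.factorial n : ℝ) - (0 + 2) ^ n / (Nat.factorial n : ℝ)
        + 2 * ((0 + 1) ^ n / (Nat.factorial n : ℝ)) - (0 + 0) ^ n / (Nat.factorial n : ℝ) := by
    norm_num
    ring
  rw [h, ← h₁, ← h₂, ← h₃, ← h₄, ← h₅, ← h₆, Finset.mul_sum, Finset.mul_sum,
    ← Finset.sum_sub_distrib, ← Finset.sum_add_distrib, ← Finset.sum_sub_distrib,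
    ← Finset.sum_add_distrib, ← Finset.sum_sub_distrib]
  refine Finset.sum_congr rfl fun p _ => ?_
  simp only [one_pow]
  ring

/-- The probability that `m + 3` uniform choices among six directions use exactly three given
ones, by inclusion-exclusion. -/
lemma sum_multinomial_three_pos (m : ℕ) :
    ∑ k ∈ (Finset.Icc 1 (m + 2) ×ˢ Finset.Icc 1 (m + 2) ×ˢ Finset.Icc 1 (m + 2)).filter
            (fun k : ℕ × ℕ × ℕ => k.1 + k.2.1 + k.2.2 = m + 3),
            ((Nat.factorial (m + 3) : ℝ) /
              ((Nat.factorial k.1 : ℝ) * (Nat.factorial k.2.1 : ℝ) * (Nat.factorial k.2.2 : ℝ)))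
              * (1 / 6 : ℝ) ^ (m + 3)
      = (1 / 2) ^ (m + 3) - 3 * (1 / 3) ^ (m + 3) + 3 * (1 / 6) ^ (m + 3) := by
  have key := sum_antidiagonal_antidiagonal_pos_div_factorial (m + 3)
  rw [Finset.sum_sigma'] at key
  have hn : (Nat.factorial (m + 3) : ℝ) ≠ 0 := by positivity
  have e₁ : (1 / 2 : ℝ) ^ (m + 3) = 3 ^ (m + 3) * (1 / 6) ^ (m + 3) := by
    rw [← mul_pow]; norm_num
  have e₂ : (1 / 3 : ℝ) ^ (m + 3) = 2 ^ (m + 3) * (1 / 6) ^ (m + 3) := by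
    rw [← mul_pow]; norm_num
  have hr : (1 / 2 : ℝ) ^ (m + 3) - 3 * (1 / 3) ^ (m + 3) + 3 * (1 / 6) ^ (m + 3)
      = ((3 ^ (m + 3) - 3 * 2 ^ (m + 3) + 3 - 0 ^ (m + 3)) / (Nat.factorial (m + 3) : ℝ))
        * ((Nat.factorial (m + 3) : ℝ) * (1 / 6) ^ (m + 3)) := by
    rw [e₁, e₂, zero_pow (by omega)]
    field_simp
    ring
  rw [hr, ← key, Finset.sum_mul]
  refine Finset.sum_of_injOn
    (fun k : ℕ × ℕ × ℕ => (⟨(k.1, k.2.1 + k.2.2), (k.2.1, k.2.2)⟩ : (_ : ℕ × ℕ) × ℕ × ℕ))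
    ?_ ?_ ?_ ?_
  · rintro ⟨a, b, c⟩ _ ⟨a', b', c'⟩ _ h
    simp only [Sigma.mk.injEq, Prod.mk.injEq, heq_eq_eq] at h ⊢
    tauto
  · rintro ⟨a, b, c⟩ h
    simp only [Finset.coe_filter, Finset.mem_product, Finset.mem_Icc, Set.mem_ofPred_eq] at h
    simp only [Finset.mem_coe, Finset.mem_sigma, Finset.HasAntidiagonal.mem_antidiagonal]
    exact ⟨by omega, trivial⟩
  · rintro ⟨⟨a, s⟩, b, c⟩ h hk
    simp only [Finset.mem_sigma, Finset.HasAntidiagonal.mem_antidiagonal] at h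
    obtain ⟨h₁, rfl⟩ := h
    have hz : a = 0 ∨ b = 0 ∨ c = 0 := by
      by_contra! hne
      refine hk ⟨(a, b, c), ?_, rfl⟩
      simp only [Finset.coe_filter, Finset.mem_product, Finset.mem_Icc, Set.mem_ofPred_eq]
      omega
    rcases hz with rfl | rfl | rfl <;> simp
  · rintro ⟨a, b, c⟩ h
    simp only [Finset.mem_filter, Finset.mem_product, Finset.mem_Icc] at h
    simp only [zero_pow (show a ≠ 0 by omega), zero_pow (show b ≠ 0 by omega),
      zero_pow (show c ≠ 0 by omega)]
    field_simp
    ring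

/-- The expectation of `c ^ (N + 1)` for a Poisson variable `N` of mean `L`. -/
lemma hasSum_poisson_mul_pow_succ (L c : ℝ) :
    HasSum (fun n : ℕ => Real.exp (-L) * L ^ n / (Nat.factorial n : ℝ) * c ^ (n + 1))
      (c * Real.exp (-L + c * L)) := by
  have h := (NormedSpace.expSeries_div_hasSum_exp (c * L)).mul_left (c * Real.exp (-L))
  rw [← Real.exp_eq_exp_ℝ, mul_assoc, ← Real.exp_add] at h
  have hf : (fun n : ℕ => Real.exp (-L) * L ^ n / (Nat.factorial n : ℝ) * c ^ (n + 1))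
      = fun n : ℕ => c * Real.exp (-L) * ((c * L) ^ n / (Nat.factorial n : ℝ)) := by
    funext n
    rw [mul_pow]
    ring
  rw [hf]
  exact h


theorem OUM_face_probability (L : ℝ) (hL : 0 ≤ L) :
    8 * ∑' m : ℕ, (Real.exp (-L) * L ^ (m + 2) / (Nat.factorial (m + 2) : ℝ))
        * ∑ k ∈ (Finset.Icc 1 (m + 2) ×ˢ Finset.Icc 1 (m + 2) ×ˢ Finset.Icc 1 (m + 2)).filter
            (fun k : ℕ × ℕ × ℕ => k.1 + k.2.1 + k.2.2 = m + 3),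
            ((Nat.factorial (m + 3) : ℝ) /
              ((Nat.factorial k.1 : ℝ) * (Nat.factorial k.2.1 : ℝ) * (Nat.factorial k.2.2 : ℝ)))
              * (1 / 6 : ℝ) ^ (m + 3)
    = 4 * (Real.exp (-L / 2) - 2 * Real.exp (-2 * L / 3) + Real.exp (-5 * L / 6)) := by
  simp only [sum_multinomial_three_pos]
  have h := ((hasSum_poisson_mul_pow_succ L (1 / 2)).sub
    ((hasSum_poisson_mul_pow_succ L (1 / 3)).mul_left 3)).add
    ((hasSum_poisson_mul_pow_succ L (1 / 6)).mul_left 3)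
  rw [← hasSum_nat_add_iff' 2] at h
  refine (congrArg (8 * ·) ((tsum_congr fun m => ?_).trans h.tsum_eq)).trans ?_
  · ring
  have a₁ : -L + 1 / 2 * L = -L / 2 := by ring
  have a₂ : -L + 1 / 3 * L = -2 * L / 3 := by ring
  have a₃ : -L + 1 / 6 * L = -5 * L / 6 := by ring
  rw [a₁, a₂, a₃]
  simp only [Finset.sum_range_succ, Finset.sum_range_zero, Nat.factorial]
  norm_num
  ring
end
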